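/- arXiv:2209.13095 — 12 statements merged into one kernel-verified Lean document; each statement's English description precedes it below -/
import Mathlib

section
/- Let n ≥ 1, d ≥ 1, and let f_1,…,f_n : ℝ^d → ℝ be convex functions. Suppose the n-agent network is k-redundant for some 0 ≤ k ≤ n−1, and that argmin_x Σ_{i∈S} f_i(x) is nonempty for every subset S ⊆ {1,…,n} with |S| = n−k. Then for any subsets S, L ⊆ {1,…,n} with |S| = n−k and |L| ≥ n−k, argmin_x Σ_{i∈S} f_i(x) = argmin_x Σ_{i∈L} f_i(x). -/
/-- The set of minimizers of `g` over `ℝ^d`. -/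
def argminSet {d : ℕ} (g : EuclideanSpace ℝ (Fin d) → ℝ) : Set (EuclideanSpace ℝ (Fin d)) :=
  {x | ∀ y, g x ≤ g y}

/-- An `n`-agent network with objectives `f` is `k`-redundant if any two subsets of agents of
cardinality `n - k` have the same set of minimizers of the sum of their objectives. -/
def Redundant (n d k : ℕ) (f : Fin n → EuclideanSpace ℝ (Fin d) → ℝ) : Prop :=
  ∀ S₁ S₂ : Finset (Fin n), S₁.card = n - k → S₂.card = n - k →
    argminSet (fun x => ∑ i ∈ S₁, f i x) = argminSet (fun x => ∑ i ∈ S₂, f i x)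

/-- If finitely many functions have the same nonempty set of minimizers, their sum has it too. -/
theorem argminSet_sum_eq {ι : Type*} {d : ℕ} {J : Finset ι} (hJ : J.Nonempty)
    {g : ι → EuclideanSpace ℝ (Fin d) → ℝ} {X : Set (EuclideanSpace ℝ (Fin d))}
    (hX : X.Nonempty) (hg : ∀ j ∈ J, argminSet (g j) = X) :
    argminSet (fun x => ∑ j ∈ J, g j x) = X := by
  have hmin : ∀ x ∈ X, ∀ j ∈ J, ∀ y, g j x ≤ g j y := by
    intro x hx j hj
    rw [← hg j hj] at hx
    exact hx
  ext y
  constructor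
  · intro hy
    obtain ⟨x, hx⟩ := hX
    obtain ⟨j, hj⟩ := hJ
    have heq : ∑ j ∈ J, g j x = ∑ j ∈ J, g j y :=
      le_antisymm (Finset.sum_le_sum fun j hj => hmin x hx j hj y) (hy x)
    have hjxy := (Finset.sum_eq_sum_iff_of_le fun j hj => hmin x hx j hj y).1 heq j hj
    rw [← hg j hj]
    intro z
    exact hjxy ▸ hmin x hx j hj z
  · exact fun hy z => Finset.sum_le_sum fun j hj => hmin y hy j hj z

theorem argminSet_const_mul {d : ℕ} {c : ℝ} (hc : 0 < c) (g : EuclideanSpace ℝ (Fin d) → ℝ) :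
    argminSet (fun x => c * g x) = argminSet g := by
  ext x
  exact forall_congr' fun y => mul_le_mul_iff_right₀ hc

theorem sum_sum_erase_eq {ι : Type*} [DecidableEq ι] (L : Finset ι) (a : ι → ℝ) :
    ∑ i ∈ L, ∑ j ∈ L.erase i, a j = ((L.card : ℝ) - 1) * ∑ i ∈ L, a i := by
  have h : ∀ i ∈ L, ∑ j ∈ L.erase i, a j = ∑ j ∈ L, a j - a i := fun i hi =>
    Finset.sum_erase_eq_sub hi
  rw [Finset.sum_congr rfl h, Finset.sum_sub_distrib, Finset.sum_const, nsmul_eq_mul]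
  ring

/-- If all sums over `m` of the functions share a nonempty set of minimizers, so do all sums over
at least `m` of them. -/
theorem argminSet_sum_eq_of_le_card {ι : Type*} {d m : ℕ} (hm : 1 ≤ m)
    {f : ι → EuclideanSpace ℝ (Fin d) → ℝ} {X : Set (EuclideanSpace ℝ (Fin d))}
    (hX : X.Nonempty)
    (hf : ∀ T : Finset ι, T.card = m → argminSet (fun x => ∑ i ∈ T, f i x) = X)
    (L : Finset ι) (hL : m ≤ L.card) : argminSet (fun x => ∑ i ∈ L, f i x) = X := by
  classical
  obtain ⟨l, hl⟩ : ∃ l, L.card = l := ⟨_, rfl⟩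
  rw [hl] at hL
  induction l, hL using Nat.le_induction generalizing L with
  | base => exact hf L hl
  | succ l hml ih =>
    have hpos : (0 : ℝ) < (L.card : ℝ) - 1 := by
      rw [hl]
      push_cast
      have : (1 : ℝ) ≤ l := by exact_mod_cast hm.trans hml
      linarith
    rw [← argminSet_const_mul hpos]
    simp_rw [← sum_sum_erase_eq]
    refine argminSet_sum_eq (Finset.card_pos.1 (by omega)) hX fun i hi => ih _ ?_
    rw [Finset.card_erase_of_mem hi, hl, Nat.add_sub_cancel]

theorem stmt0 (n d k : ℕ) (hn : 1 ≤ n) (hd : 1 ≤ d) (hk : k ≤ n - 1)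
    (f : Fin n → EuclideanSpace ℝ (Fin d) → ℝ)
    (hconv : ∀ i, ConvexOn ℝ Set.univ (f i))
    (hred : Redundant n d k f)
    (hne : ∀ S : Finset (Fin n), S.card = n - k →
      (argminSet (fun x => ∑ i ∈ S, f i x)).Nonempty)
    (S L : Finset (Fin n)) (hS : S.card = n - k) (hL : n - k ≤ L.card) :
    argminSet (fun x => ∑ i ∈ S, f i x) = argminSet (fun x => ∑ i ∈ L, f i x) := by
  exact (argminSet_sum_eq_of_le_card (by omega) (hne S hS)
    (fun T hT => hred T S hT hS) L hL).symm
end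

section
/- Let G be a directed graph on n vertices and let r ≥ 0 and s ≥ 1 be integers with r + s ≤ n − 1 and r ≤ n − 2. If G is (r,s)-resilient, then every vertex of G has at least r + s + 1 neighbors. -/
/-- A directed graph `E` on `Fin n` (with `E j i` meaning there is an arc from `j` to `i`,
i.e. `j` is a neighbor of `i`) is `(r, s)`-resilient if every `(r, s)`-reduced graph of it is
rooted.  An `(r, s)`-reduced graph is obtained by choosing a vertex subset `S` of cardinality
`n - r`, taking the subgraph induced by `S`, and removing from each vertex at most `s` of its
incoming edges in that induced subgraph; it is rooted if some vertex of `S` reaches every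
vertex of `S` along a directed path of the reduced graph. -/
def Resilient (n : ℕ) (E : Fin n → Fin n → Prop) (r s : ℕ) : Prop :=
  ∀ S : Set (Fin n), S.ncard = n - r →
    ∀ E' : Fin n → Fin n → Prop,
      (∀ a b, E' a b → E a b ∧ a ∈ S ∧ b ∈ S) →
      (∀ b ∈ S, {a | a ∈ S ∧ E a b ∧ ¬ E' a b}.ncard ≤ s) →
      ∃ i ∈ S, ∀ j ∈ S, Relation.ReflTransGen E' i j

/-- In a finset `U` with at least `r` elements, some `r` of them can be chosen so that they cover
all but at most `s` elements of a given subset `N` with at most `r + s` elements. -/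
theorem Finset.exists_subset_card_eq_card_sdiff_le {α : Type*} [DecidableEq α] {N U : Finset α}
    {r s : ℕ} (hNU : N ⊆ U) (hN : N.card ≤ r + s) (hU : r ≤ U.card) :
    ∃ R ⊆ U, R.card = r ∧ (N \ R).card ≤ s := by
  obtain ⟨M, hMN, hM⟩ := Finset.exists_subset_card_eq (min_le_left N.card r)
  obtain ⟨R, hMR, hRU, hR⟩ := Finset.exists_subsuperset_card_eq (hMN.trans hNU)
    (hM.trans_le (min_le_right _ _)) hU
  refine ⟨R, hRU, hR, (Finset.card_le_card (Finset.sdiff_subset_sdiff le_rfl hMR)).trans ?_⟩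
  rw [Finset.card_sdiff_of_subset hMN]
  omega

/-- In an `(r, s)`-resilient graph with `1 ≤ s`, if a set `S` of `n - r` vertices contains `i` and
some other vertex, then `S` contains more than `s` neighbors of `i` other than `i`. -/
theorem Resilient.lt_ncard_neighbors {n r s : ℕ} {E : Fin n → Fin n → Prop}
    (hres : Resilient n E r s) (hs : 1 ≤ s) {S : Set (Fin n)} (hS : S.ncard = n - r)
    {i k : Fin n} (hi : i ∈ S) (hk : k ∈ S) (hki : k ≠ i) :
    s < {a | a ∈ S ∧ E a i ∧ a ≠ i}.ncard := by
  by_contra! hle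
  obtain ⟨j, -, hj⟩ := hres S hS (fun a b => E a b ∧ a ∈ S ∧ b ∈ S ∧ (a = i ↔ b = i))
    (fun a b h => ⟨h.1, h.2.1, h.2.2.1⟩) (fun b hb => by
      by_cases hbi : b = i
      · subst hbi
        refine (Set.ncard_le_ncard ?_ (Set.toFinite _)).trans hle
        rintro a ⟨ha, hab, hE⟩
        exact ⟨ha, hab, fun h => hE ⟨hab, ha, hb, by simp [h]⟩⟩
      · refine (Set.ncard_le_ncard (t := {i}) ?_ (Set.toFinite _)).trans
          ((Set.ncard_singleton i).trans_le hs)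
        rintro a ⟨ha, hab, hE⟩
        by_contra hai
        exact hE ⟨hab, ha, hb, iff_of_false hai hbi⟩)
  have key : ∀ m ∈ S, (j = i ↔ m = i) := fun m hm => by
    induction hj m hm with
    | refl => rfl
    | tail _ h ih => exact (ih h.2.1).trans h.2.2.2
  exact hki ((key k hk).1 ((key i hi).2 rfl))

theorem stmt3 (n r s : ℕ) (hs : 1 ≤ s) (hrs : r + s ≤ n - 1) (hr : r ≤ n - 2)
    (E : Fin n → Fin n → Prop) (hres : Resilient n E r s) :
    ∀ i : Fin n, r + s + 1 ≤ {j : Fin n | E j i}.ncard := by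
  classical
  intro i
  by_contra! hlt
  have hN : (Finset.univ.filter fun a => E a i ∧ a ≠ i).card ≤ r + s := by
    rw [← Set.ncard_coe_finset]
    refine (Set.ncard_le_ncard ?_ (Set.toFinite _)).trans (Nat.lt_succ_iff.1 hlt)
    intro a ha
    simp_all
  obtain ⟨R, hRU, hR, hRs⟩ := Finset.exists_subset_card_eq_card_sdiff_le
    (U := Finset.univ.erase i) (fun a ha => by simp_all) hN
    (by rw [Finset.card_erase_of_mem (Finset.mem_univ i), Finset.card_fin]; omega)
  have hi : i ∉ R := fun h => by simpa using hRU h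
  have hcard : Rᶜ.card = n - r := by rw [Finset.card_compl, Fintype.card_fin, hR]
  obtain ⟨k, hk, hki⟩ := Finset.exists_mem_ne (s := Rᶜ) (by omega) i
  refine (hres.lt_ncard_neighbors hs (S := ↑Rᶜ) (by rw [Set.ncard_coe_finset, hcard])
    (by simpa using hi) hk hki).not_ge ?_
  refine le_trans (Set.ncard_le_ncard ?_ (Set.toFinite _)) ((Set.ncard_coe_finset _).trans_le hRs)
  rintro a ⟨ha, hE⟩
  simp_all
end

section
/- Let G be a directed graph on n vertices and let r_1, s_1 ≥ 0 be integers with r_1 + s_1 ≤ n − 1 and r_1 ≤ n − 2. If G is (r_1,s_1)-resilient, then for any integers 0 ≤ r_2 ≤ r_1 and 0 ≤ s_2 ≤ s_1, G is (r_2,s_2)-resilient. -/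
/-- A finite nonempty set in which any two vertices have a common ancestor contains a vertex
reaching all of the others. -/
theorem exists_root_of_common_ancestor {α : Type*} [Finite α] {R : α → α → Prop} {S : Set α}
    (hS : S.Nonempty)
    (h : ∀ a ∈ S, ∀ b ∈ S, ∃ i ∈ S, Relation.ReflTransGen R i a ∧ Relation.ReflTransGen R i b) :
    ∃ i ∈ S, ∀ j ∈ S, Relation.ReflTransGen R i j := by
  have : Nonempty S := hS.to_subtype
  have : IsTrans α fun a b => Relation.ReflTransGen R b a := ⟨fun _ _ _ hab hbc => hbc.trans hab⟩
  have hdir : Directed (fun a b => Relation.ReflTransGen R b a) (Subtype.val : S → α) := by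
    rintro ⟨a, ha⟩ ⟨b, hb⟩
    obtain ⟨i, hi, hia, hib⟩ := h a ha b hb
    exact ⟨⟨i, hi⟩, hia, hib⟩
  obtain ⟨z, hz⟩ := hdir.finite_set_le Set.finite_univ
  exact ⟨z, z.2, fun j hj => hz ⟨j, hj⟩ trivial⟩

/-- In a reduced graph obtained by deleting fewer vertices than a resilient graph tolerates, every
set of the tolerated size contains a vertex reaching all of it. -/
theorem Resilient.exists_root_subset {n r s t : ℕ} {E : Fin n → Fin n → Prop}
    (hres : Resilient n E r s) (hts : t ≤ s) {S T : Set (Fin n)} (hTS : T ⊆ S)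
    (hT : T.ncard = n - r) {E' : Fin n → Fin n → Prop} (hE' : ∀ a b, E' a b → E a b)
    (hdel : ∀ b ∈ S, {a | a ∈ S ∧ E a b ∧ ¬ E' a b}.ncard ≤ t) :
    ∃ i ∈ T, ∀ j ∈ T, Relation.ReflTransGen E' i j := by
  obtain ⟨i, hi, hroot⟩ := hres T hT (fun a b => E' a b ∧ a ∈ T ∧ b ∈ T)
    (fun a b h => ⟨hE' a b h.1, h.2⟩) fun b hb => by
      refine (Set.ncard_le_ncard ?_).trans ((hdel b (hTS hb)).trans hts)
      rintro a ⟨ha, hab, hn⟩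
      exact ⟨hTS ha, hab, fun h => hn ⟨h, ha, hb⟩⟩
  exact ⟨i, hi, fun j hj => Relation.ReflTransGen.mono (fun _ _ h => h.1) _ _ (hroot j hj)⟩

theorem stmt4 (n r₁ s₁ : ℕ) (hrs : r₁ + s₁ ≤ n - 1) (hr : r₁ ≤ n - 2)
    (E : Fin n → Fin n → Prop) (hres : Resilient n E r₁ s₁)
    (r₂ s₂ : ℕ) (hr2 : r₂ ≤ r₁) (hs2 : s₂ ≤ s₁) :
    Resilient n E r₂ s₂ := by
  intro S hS E' hE' hdel
  have hroot {T : Set (Fin n)} (hTS : T ⊆ S) (hT : T.ncard = n - r₁) :=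
    hres.exists_root_subset hs2 hTS hT (fun a b h => (hE' a b h).1) hdel
  rcases lt_or_ge n 2 with hn | hn
  · exact hroot subset_rfl (by omega)
  · refine exists_root_of_common_ancestor
      (Set.nonempty_of_ncard_ne_zero (by omega)) fun a ha b hb => ?_
    have hab : ({a, b} : Set (Fin n)) ⊆ S := Set.pair_subset ha hb
    have hcard : ({a, b} : Set (Fin n)).ncard ≤ 2 := by
      simpa using Set.ncard_insert_le a {b}
    obtain ⟨T, habT, hTS, hT⟩ := Set.exists_subsuperset_card_eq (n := n - r₁) hab
      (by omega) (by omega)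
    obtain ⟨i, hi, h⟩ := hroot hTS hT
    exact ⟨i, hTS hi, h a (habT (by simp)), h b (habT (by simp))⟩
end

section
/- Let d ≥ 1 and β ≥ 0 be integers, let A be a finite set with |A| = (d+1)β + 1, and let x : A → ℝ^d. Then the intersection, over all subsets P ⊆ A with |P| = dβ + 1, of the convex hulls of {x_a : a ∈ P}, is nonempty; that is, ⋂_{P ⊆ A, |P| = dβ+1} conv{x_a : a ∈ P} ≠ ∅. -/
/-- If the complements of a family of finsets are too small to cover the ambient type, then the
finsets have a common element. -/
theorem Finset.exists_forall_mem_of_card_mul_lt {A : Type*} [Fintype A] [DecidableEq A]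
    {I : Finset (Finset A)} {k : ℕ} (hI : ∀ P ∈ I, Pᶜ.card ≤ k)
    (hlt : I.card * k < Fintype.card A) : ∃ a, ∀ P ∈ I, a ∈ P := by
  have hcard : (I.biUnion fun P => Pᶜ).card < Fintype.card A :=
    (Finset.card_biUnion_le_card_mul I _ k hI).trans_lt hlt
  obtain ⟨a, ha⟩ : ∃ a, a ∉ I.biUnion fun P => Pᶜ := by
    simpa only [ne_eq, Finset.eq_univ_iff_forall, not_forall] using
      (Finset.card_lt_iff_ne_univ _).1 hcard
  refine ⟨a, fun P hP => ?_⟩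
  by_contra h
  exact ha (Finset.mem_biUnion.2 ⟨P, hP, Finset.mem_compl.2 h⟩)

theorem stmt5 (d β : ℕ) (hd : 1 ≤ d) (A : Type*) [Fintype A] [DecidableEq A]
    (hA : Fintype.card A = (d + 1) * β + 1)
    (x : A → EuclideanSpace ℝ (Fin d)) :
    ∃ y : EuclideanSpace ℝ (Fin d),
      ∀ P : Finset A, P.card = d * β + 1 → y ∈ convexHull ℝ (x '' ↑P) := by
  obtain ⟨y, hy⟩ := Convex.helly_theorem' (𝕜 := ℝ)
    (F := fun P : Finset A => convexHull ℝ (x '' (P : Set A)))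
    (s := Finset.univ.powersetCard (d * β + 1)) (fun _ _ => convex_convexHull ℝ _) <| by
      intro I hIs hI
      rw [finrank_euclideanSpace_fin] at hI
      obtain ⟨a, ha⟩ := Finset.exists_forall_mem_of_card_mul_lt (I := I) (k := β)
        (fun P hP => by
          rw [Finset.card_compl, hA, (Finset.mem_powersetCard.1 (hIs hP)).2, Nat.succ_mul]
          omega)
        (by rw [hA]; exact Nat.lt_succ_of_le (Nat.mul_le_mul_right β hI))
      exact ⟨x a, Set.mem_iInter₂.2 fun P hP =>
        subset_convexHull ℝ _ (Set.mem_image_of_mem x (ha P hP))⟩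
  exact ⟨y, fun P hP => Set.mem_iInter₂.1 hy P
    (Finset.mem_powersetCard.2 ⟨Finset.subset_univ P, hP⟩)⟩
end

section
/- Let d ≥ 1 and β ≥ 0 be integers, V a finite set, x : V → ℝ^d, i ∈ V, N ⊆ V∖{i} with |N| ≥ (d+1)β + 1, and F ⊆ N with |F| ≤ β. Let 𝒜 be the family of all subsets of N of cardinality (d+1)β + 1 and let a = |𝒜|. Suppose that for each A ∈ 𝒜 a point y_A ∈ ℝ^d satisfies y_A ∈ conv{x_p : p ∈ P} for every subset P ⊆ A with |P| = dβ + 1. Let v = (1/(1+a))(x_i + Σ_{A∈𝒜} y_A) and η = 1 / ((dβ+1)(1+a)·C((d+1)β+1, dβ+1)), where C(·,·) is the binomial coefficient. Then there exist nonnegative real weights w_i and (w_k)_{k∈N∖F} with w_i + Σ_{k∈N∖F} w_k = 1 such that v = w_i x_i + Σ_{k∈N∖F} w_k x_k, w_i ≥ η, and at least |N∖F| − dβ of the weights w_k, k ∈ N∖F, satisfy w_k ≥ η. -/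
theorem exists_weights_of_mem_convexHull_image {ι E : Type*} [DecidableEq ι] [AddCommGroup E]
    [Module ℝ E] {x : ι → E} {P B : Finset ι} (hPB : P ⊆ B) {y : E}
    (hy : y ∈ convexHull ℝ (x '' (P : Set ι))) :
    ∃ α : ι → ℝ, (∀ k, 0 ≤ α k) ∧ (∀ k ∉ P, α k = 0) ∧ ∑ k ∈ B, α k = 1 ∧
      ∑ k ∈ B, α k • x k = y := by
  refine convexHull_min (t := {y | ∃ α : ι → ℝ, (∀ k, 0 ≤ α k) ∧ (∀ k ∉ P, α k = 0) ∧
    ∑ k ∈ B, α k = 1 ∧ ∑ k ∈ B, α k • x k = y}) ?_ ?_ hy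
  · rintro _ ⟨p, hp, rfl⟩
    have hpB : p ∈ B := hPB hp
    refine ⟨fun k => if k = p then 1 else 0, fun k => by positivity, fun k hk => ?_, ?_, ?_⟩
    · exact if_neg (ne_of_mem_of_not_mem hp hk).symm
    · simp [hpB]
    · simp [hpB]
  · rintro _ ⟨α, hα, hα', hα1, rfl⟩ _ ⟨γ, hγ, hγ', hγ1, rfl⟩ s t hs ht hst
    refine ⟨fun k => s * α k + t * γ k, fun k => ?_, fun k hk => ?_, ?_, ?_⟩
    · have := hα k
      have := hγ k
      positivity
    · simp [hα' k hk, hγ' k hk]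
    · rw [Finset.sum_add_distrib, ← Finset.mul_sum, ← Finset.mul_sum, hα1, hγ1, mul_one, mul_one,
        hst]
    · simp only [add_smul, mul_smul, Finset.sum_add_distrib, Finset.smul_sum]

/-- A point lying in the convex hull of every `m`-element subfamily of `B` is a convex combination
of `B` giving some member of each such subfamily weight at least `1 / (m * choose #B m)`. -/
theorem exists_weights_of_forall_mem_convexHull_image {ι E : Type*} [DecidableEq ι]
    [AddCommGroup E] [Module ℝ E] {x : ι → E} {B : Finset ι} {m : ℕ} (hm : 0 < m)
    (hB : m ≤ B.card) {y : E}
    (hy : ∀ P ∈ B.powersetCard m, y ∈ convexHull ℝ (x '' (P : Set ι))) :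
    ∃ α : ι → ℝ, (∀ k, 0 ≤ α k) ∧ (∀ k ∉ B, α k = 0) ∧ ∑ k ∈ B, α k = 1 ∧
      ∑ k ∈ B, α k • x k = y ∧
      ∀ P ∈ B.powersetCard m, ∃ k ∈ P, 1 / (m * (B.card.choose m : ℝ)) ≤ α k := by
  have hsub : ∀ P ∈ B.powersetCard m, P ⊆ B := fun P hP => (Finset.mem_powersetCard.1 hP).1
  choose! α h0 hP h1 hsum using fun P hP =>
    exists_weights_of_mem_convexHull_image (hsub P hP) (hy P hP)
  have hc : (0 : ℝ) < B.card.choose m := by exact_mod_cast Nat.choose_pos hB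
  have hm' : (0 : ℝ) < m := by exact_mod_cast hm
  refine ⟨fun k => (B.card.choose m : ℝ)⁻¹ * ∑ P ∈ B.powersetCard m, α P k, fun k => ?_,
    fun k hk => ?_, ?_, ?_, fun P hPm => ?_⟩
  · exact mul_nonneg (inv_nonneg.2 hc.le) (Finset.sum_nonneg fun P hP => h0 P hP k)
  · exact mul_eq_zero_of_right _
      (Finset.sum_eq_zero fun P hPm => hP P hPm k fun h => hk (hsub P hPm h))
  · rw [← Finset.mul_sum, Finset.sum_comm, Finset.sum_congr rfl h1, Finset.sum_const,
      Finset.card_powersetCard, nsmul_one, inv_mul_cancel₀ hc.ne']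
  · simp only [mul_smul, Finset.sum_smul]
    rw [← Finset.smul_sum, Finset.sum_comm, Finset.sum_congr rfl hsum, Finset.sum_const,
      Finset.card_powersetCard, ← Nat.cast_smul_eq_nsmul ℝ, inv_smul_smul₀ hc.ne']
  · obtain ⟨hPB, hcard⟩ := Finset.mem_powersetCard.1 hPm
    have hPsum : ∑ k ∈ P, α P k = 1 := by
      rw [← h1 P hPm]
      exact Finset.sum_subset hPB fun k _ hk => hP P hPm k hk
    obtain ⟨k, hk, hle⟩ : ∃ k ∈ P, 1 / (m : ℝ) ≤ α P k := by
      refine Finset.exists_le_of_sum_le (Finset.card_pos.1 (hcard ▸ hm)) ?_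
      rw [hPsum, Finset.sum_const, hcard, nsmul_eq_mul, mul_one_div_cancel hm'.ne']
    refine ⟨k, hk, ?_⟩
    calc 1 / (m * (B.card.choose m : ℝ)) = (B.card.choose m : ℝ)⁻¹ * (1 / m) := by
          field_simp
      _ ≤ (B.card.choose m : ℝ)⁻¹ * ∑ P ∈ B.powersetCard m, α P k := by
          gcongr
          exact hle.trans
            (Finset.single_le_sum (f := fun Q => α Q k) (fun Q hQ => h0 Q hQ k) hPm)

theorem stmt8 (d β : ℕ) (hd : 1 ≤ d)
    (V : Type*) [Fintype V] [DecidableEq V]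
    (x : V → EuclideanSpace ℝ (Fin d))
    (i : V) (N : Finset V) (hiN : i ∉ N) (hN : (d + 1) * β + 1 ≤ N.card)
    (F : Finset V) (hFN : F ⊆ N) (hF : F.card ≤ β)
    (y : Finset V → EuclideanSpace ℝ (Fin d))
    (hy : ∀ A ∈ N.powersetCard ((d + 1) * β + 1),
      ∀ P ⊆ A, P.card = d * β + 1 → y A ∈ convexHull ℝ (x '' ↑P))
    (a : ℕ) (ha : a = (N.powersetCard ((d + 1) * β + 1)).card)
    (v : EuclideanSpace ℝ (Fin d))
    (hv : v = ((1 : ℝ) / (1 + a)) •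
      (x i + ∑ A ∈ N.powersetCard ((d + 1) * β + 1), y A))
    (η : ℝ)
    (hη : η = 1 / ((d * β + 1) * (1 + a) * Nat.choose ((d + 1) * β + 1) (d * β + 1))) :
    ∃ (wi : ℝ) (w : V → ℝ),
      0 ≤ wi ∧ (∀ k ∈ N \ F, 0 ≤ w k) ∧
      wi + ∑ k ∈ N \ F, w k = 1 ∧
      v = wi • x i + ∑ k ∈ N \ F, w k • x k ∧
      η ≤ wi ∧
      (N \ F).card - d * β ≤ {k : V | k ∈ N \ F ∧ η ≤ w k}.ncard := by
  have hle : d * β + 1 ≤ (d + 1) * β + 1 := by nlinarith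
  have hcardB : ∀ A ∈ N.powersetCard ((d + 1) * β + 1), d * β + 1 ≤ (A \ F).card := by
    intro A hA
    have h := Finset.le_card_sdiff F A
    rw [(Finset.mem_powersetCard.1 hA).2, add_mul, one_mul] at h
    omega
  choose! α h0 hoff h1 hsum hbig using fun A hA =>
    exists_weights_of_forall_mem_convexHull_image (Nat.succ_pos _) (hcardB A hA)
      fun P hP => hy A hA P ((Finset.mem_powersetCard.1 hP).1.trans Finset.sdiff_subset)
        (Finset.mem_powersetCard.1 hP).2
  have hsub : ∀ A ∈ N.powersetCard ((d + 1) * β + 1), A \ F ⊆ N \ F := fun A hA =>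
    Finset.sdiff_subset_sdiff (Finset.mem_powersetCard.1 hA).1 le_rfl
  have h1' : ∀ A ∈ N.powersetCard ((d + 1) * β + 1), ∑ k ∈ N \ F, α A k = 1 := by
    intro A hA
    rw [← h1 A hA]
    exact (Finset.sum_subset (hsub A hA) fun k _ hk => hoff A hA k hk).symm
  have hsum' : ∀ A ∈ N.powersetCard ((d + 1) * β + 1), ∑ k ∈ N \ F, α A k • x k = y A := by
    intro A hA
    rw [← hsum A hA]
    exact (Finset.sum_subset (hsub A hA) fun k _ hk => by rw [hoff A hA k hk, zero_smul]).symm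
  have ha0 : (0 : ℝ) < 1 + a := by positivity
  have hC : 1 ≤ ((d + 1) * β + 1).choose (d * β + 1) := Nat.choose_pos hle
  have hC' : (1 : ℝ) ≤ ((d + 1) * β + 1).choose (d * β + 1) := by exact_mod_cast hC
  set w : V → ℝ := fun k => (1 / (1 + a : ℝ)) * ∑ A ∈ N.powersetCard ((d + 1) * β + 1), α A k
    with hw
  refine ⟨1 / (1 + a), w, by positivity, fun k _ => ?_, ?_, ?_, ?_, ?_⟩
  · exact mul_nonneg (by positivity) (Finset.sum_nonneg fun A hA => h0 A hA k)
  · rw [hw, ← Finset.mul_sum, Finset.sum_comm, Finset.sum_congr rfl h1', Finset.sum_const, ← ha,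
      nsmul_one]
    field_simp
  · rw [hv, hw]
    simp only [mul_smul, Finset.sum_smul]
    rw [← Finset.smul_sum, Finset.sum_comm, Finset.sum_congr rfl hsum', smul_add]
  · rw [hη]
    refine one_div_le_one_div_of_le ha0 ?_
    have h2 : (1 : ℝ) ≤ d * β + 1 := le_add_of_nonneg_left (by positivity)
    calc (1 + a : ℝ) = 1 * (1 + a) * 1 := by ring
      _ ≤ _ := by gcongr
  · have hset : {k : V | k ∈ N \ F ∧ η ≤ w k} = ((N \ F).filter fun k => η ≤ w k : Finset V) := by
      ext k
      simp
    rw [hset, Set.ncard_coe_finset]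
    have hsplit := Finset.card_filter_add_card_filter_not (s := N \ F) fun k => η ≤ w k
    suffices h : ((N \ F).filter fun k => ¬ η ≤ w k).card ≤ d * β by omega
    by_contra! hlt
    obtain ⟨P, hPT, hPc⟩ := Finset.exists_subset_card_eq (Nat.succ_le_of_lt hlt)
    have hPG : P ⊆ N \ F := hPT.trans (Finset.filter_subset _ _)
    obtain ⟨A, hPA, hAN, hAc⟩ := Finset.exists_subsuperset_card_eq
      (hPG.trans Finset.sdiff_subset) (hPc.le.trans hle) hN
    have hA : A ∈ N.powersetCard ((d + 1) * β + 1) := Finset.mem_powersetCard.2 ⟨hAN, hAc⟩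
    have hPm : P ∈ (A \ F).powersetCard (d * β + 1) := Finset.mem_powersetCard.2
      ⟨fun k hk => Finset.mem_sdiff.2 ⟨hPA hk, (Finset.mem_sdiff.1 (hPG hk)).2⟩, hPc⟩
    obtain ⟨k, hk, hαk⟩ := hbig A hA P hPm
    refine (Finset.mem_filter.1 (hPT hk)).2.not_ge ?_
    have hchoose : (((A \ F).card.choose (d * β + 1) : ℕ) : ℝ) ≤
        ((d + 1) * β + 1).choose (d * β + 1) := by
      exact_mod_cast Nat.choose_le_choose _ (hAc ▸ Finset.card_le_card Finset.sdiff_subset)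
    have hpos : (0 : ℝ) < (A \ F).card.choose (d * β + 1) := by
      exact_mod_cast Nat.choose_pos (hcardB A hA)
    calc η = (1 / (1 + a)) *
          (1 / ((d * β + 1) * ((d + 1) * β + 1).choose (d * β + 1))) := by
          rw [hη]
          field_simp
      _ ≤ (1 / (1 + a)) * (1 / ((d * β + 1 : ℕ) * ((A \ F).card.choose (d * β + 1) : ℝ))) := by
          push_cast
          gcongr
      _ ≤ (1 / (1 + a)) * α A k := by gcongr
      _ ≤ w k := by
          exact mul_le_mul_of_nonneg_left
            (Finset.single_le_sum (f := fun A => α A k) (fun A hA => h0 A hA k) hA)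
            (by positivity)
end

section
/- Let n ≥ 1 and p ∈ (0,1], and let S_1, S_2, S_3, … be an infinite sequence of n×n row-stochastic matrices such that for each t: (S_t)_{ii} ≥ p for all i, and there exists a rooted directed graph G_t on the vertex set {1,…,n} such that (S_t)_{ji} ≥ p whenever (i,j) is an arc of G_t. Then there exist a vector v ∈ ℝⁿ and constants c ≥ 0 and μ ∈ [0,1) such that for all k ≥ 1 and all i,j, |(S_k S_{k−1} ⋯ S_1)_{ij} − v_j| ≤ c μ^k; that is, the left products S_k ⋯ S_2 S_1 converge exponentially fast to the rank-one matrix 𝟙vᵀ. -/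
/-- `prodUpTo n S k = S (k-1) * ⋯ * S 1 * S 0`, the left product of the first `k` matrices
of the sequence `S` (so, with the sequence viewed as `S_1, S_2, …` via `S_t = S (t-1)`,
`prodUpTo n S k` is `S_k ⋯ S_2 S_1`). -/
def prodUpTo (n : ℕ) (S : ℕ → Matrix (Fin n) (Fin n) ℝ) : ℕ → Matrix (Fin n) (Fin n) ℝ
  | 0 => 1
  | k + 1 => S k * prodUpTo n S k

open Filter Topology

/-- A nonnegative matrix with row sums one. -/
def IsRowStochastic {n : ℕ} (W : Matrix (Fin n) (Fin n) ℝ) : Prop :=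
  (∀ i j, 0 ≤ W i j) ∧ ∀ i, ∑ j, W i j = 1

/-- All differences of entries in column `j` of `M` are at most `d`. -/
def ColumnOscLE {n : ℕ} (M : Matrix (Fin n) (Fin n) ℝ) (j : Fin n) (d : ℝ) : Prop :=
  ∀ a b, M a j - M b j ≤ d

/-- The entries of `A` are at least `p` along the arcs of some rooted graph, with each arc
`(i, j)` read at position `(j, i)`. -/
def HasRootedGraph {n : ℕ} (p : ℝ) (A : Matrix (Fin n) (Fin n) ℝ) : Prop :=
  ∃ G : Fin n → Fin n → Prop,
    (∃ i, ∀ j, Relation.ReflTransGen G i j) ∧ ∀ i j, G i j → p ≤ A j i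

theorem IsRowStochastic.one {n : ℕ} : IsRowStochastic (1 : Matrix (Fin n) (Fin n) ℝ) := by
  refine ⟨fun i j => ?_, fun i => ?_⟩
  · rw [Matrix.one_apply]
    split_ifs <;> norm_num
  · simp [Matrix.one_apply]

theorem IsRowStochastic.mul {n : ℕ} {A B : Matrix (Fin n) (Fin n) ℝ}
    (hA : IsRowStochastic A) (hB : IsRowStochastic B) : IsRowStochastic (A * B) := by
  refine ⟨fun i j => ?_, fun i => ?_⟩
  · rw [Matrix.mul_apply]
    exact Finset.sum_nonneg fun l _ => mul_nonneg (hA.1 i l) (hB.1 l j)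
  · simp only [Matrix.mul_apply]
    rw [Finset.sum_comm]
    simp [← Finset.mul_sum, hB.2, hA.2]

theorem isRowStochastic_prodUpTo {n : ℕ} {S : ℕ → Matrix (Fin n) (Fin n) ℝ}
    (hS : ∀ t, IsRowStochastic (S t)) (k : ℕ) : IsRowStochastic (prodUpTo n S k) := by
  induction k with
  | zero => exact IsRowStochastic.one
  | succ k ih => exact (hS k).mul ih

theorem prodUpTo_add (n : ℕ) (S : ℕ → Matrix (Fin n) (Fin n) ℝ) (m s : ℕ) :
    prodUpTo n S (m + s) = prodUpTo n (fun t => S (m + t)) s * prodUpTo n S m := by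
  induction s with
  | zero => simp [prodUpTo]
  | succ s ih => rw [← add_assoc, prodUpTo, ih, prodUpTo, Matrix.mul_assoc]

theorem prodUpTo_succ_right (n : ℕ) (S : ℕ → Matrix (Fin n) (Fin n) ℝ) (s : ℕ) :
    prodUpTo n S (s + 1) = prodUpTo n (fun t => S (t + 1)) s * S 0 := by
  rw [add_comm s 1, prodUpTo_add]
  simp [prodUpTo, add_comm]

theorem IsRowStochastic.abs_mul_sub_le {n : ℕ} {W M : Matrix (Fin n) (Fin n) ℝ}
    (hW : IsRowStochastic W) {j : Fin n} {d : ℝ} (hM : ColumnOscLE M j d) (a b : Fin n) :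
    |(W * M) a j - M b j| ≤ d := by
  have h : (W * M) a j - M b j = ∑ l, W a l * (M l j - M b j) := by
    simp only [mul_sub, Finset.sum_sub_distrib, ← Finset.sum_mul, hW.2, one_mul,
      Matrix.mul_apply]
  rw [h]
  calc |∑ l, W a l * (M l j - M b j)| ≤ ∑ l, |W a l * (M l j - M b j)| :=
        Finset.abs_sum_le_sum_abs _ _
    _ ≤ ∑ l, W a l * d := by
        refine Finset.sum_le_sum fun l _ => ?_
        rw [abs_mul, abs_of_nonneg (hW.1 a l)]
        refine mul_le_mul_of_nonneg_left (abs_le.2 ⟨?_, hM l b⟩) (hW.1 a l)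
        linarith [hM b l]
    _ = d := by rw [← Finset.sum_mul, hW.2, one_mul]

theorem IsRowStochastic.mul_sub_mul_le {n : ℕ} {W M : Matrix (Fin n) (Fin n) ℝ}
    (hW : IsRowStochastic W) {j : Fin n} {d : ℝ} (hM : ColumnOscLE M j d) (a b l₀ : Fin n) :
    (W * M) a j - (W * M) b j ≤ (1 - W a l₀ * W b l₀) * d := by
  have hd : ∀ l m, W a l * W b m * (M l j - M m j) ≤
      W a l * W b m * d - if l = l₀ then (if m = l₀ then W a l₀ * W b l₀ * d else 0) else 0 := by
    intro l m
    have key := mul_le_mul_of_nonneg_left (hM l m) (mul_nonneg (hW.1 a l) (hW.1 b m))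
    split_ifs with h₁ h₂
    · subst h₁
      subst h₂
      simp
    · simpa using key
    · simpa using key
  have h₁ : (W * M) a j - (W * M) b j = ∑ l, ∑ m, W a l * W b m * (M l j - M m j) := by
    have e₁ : ∑ l, ∑ m, W a l * W b m * M l j = (W * M) a j := by
      rw [Matrix.mul_apply]
      refine Finset.sum_congr rfl fun l _ => ?_
      rw [← Finset.sum_mul, ← Finset.mul_sum, hW.2, mul_one]
    have e₂ : ∑ l, ∑ m, W a l * W b m * M m j = (W * M) b j := by
      simp only [mul_assoc, ← Finset.mul_sum]
      rw [← Finset.sum_mul, hW.2, one_mul, Matrix.mul_apply]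
    rw [← e₁, ← e₂]
    simp only [mul_sub, Finset.sum_sub_distrib]
  have h₂ : ∑ l, ∑ m, W a l * W b m * d = d := by
    simp only [← Finset.sum_mul, ← Finset.mul_sum, hW.2, mul_one, one_mul]
  calc (W * M) a j - (W * M) b j ≤ ∑ l, ∑ m, (W a l * W b m * d -
        if l = l₀ then (if m = l₀ then W a l₀ * W b l₀ * d else 0) else 0) := by
        rw [h₁]
        exact Finset.sum_le_sum fun l _ => Finset.sum_le_sum fun m _ => hd l m
    _ = (1 - W a l₀ * W b l₀) * d := by
        simp only [Finset.sum_sub_distrib, h₂]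
        simp [sub_mul]

theorem exists_arc_into {α : Type*} {G : α → α → Prop} {A : Finset α} {r w : α}
    (h : Relation.ReflTransGen G r w) (hr : r ∉ A) (hw : w ∈ A) :
    ∃ u v, u ∉ A ∧ v ∈ A ∧ G u v := by
  induction h with
  | refl => exact absurd hw hr
  | @tail b c _ hbc ih =>
    by_cases hb : b ∈ A
    · exact ih hb
    · exact ⟨b, c, hb, hw, hbc⟩

theorem pow_succ_le_mul_apply {n : ℕ} {p : ℝ} (hp : 0 < p) {s : ℕ}
    {W A : Matrix (Fin n) (Fin n) ℝ} (hW : IsRowStochastic W) (hA : IsRowStochastic A)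
    {i l m : Fin n} (h₁ : p ^ s ≤ W i l) (h₂ : p ≤ A l m) : p ^ (s + 1) ≤ (W * A) i m := by
  rw [Matrix.mul_apply, pow_succ]
  calc p ^ s * p ≤ W i l * A l m := mul_le_mul h₁ h₂ hp.le (hW.1 i l)
    _ ≤ _ := Finset.single_le_sum (f := fun l => W i l * A l m)
        (fun l _ => mul_nonneg (hW.1 i l) (hA.1 l m)) (Finset.mem_univ l)

/-- Two rows of a product of `s` matrices have large entries on sets of columns which either
meet or have at least `s + 2` elements in total. -/
theorem exists_large_columns {n : ℕ} {p : ℝ} (hp : 0 < p) (s : ℕ) :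
    ∀ S : ℕ → Matrix (Fin n) (Fin n) ℝ, (∀ t, IsRowStochastic (S t)) →
      (∀ t i, p ≤ S t i i) → (∀ t, HasRootedGraph p (S t)) → ∀ i j,
      ∃ A B : Finset (Fin n), i ∈ A ∧ j ∈ B ∧ (∀ l ∈ A, p ^ s ≤ prodUpTo n S s i l) ∧
        (∀ l ∈ B, p ^ s ≤ prodUpTo n S s j l) ∧ (Disjoint A B → s + 2 ≤ A.card + B.card) := by
  induction s with
  | zero =>
    intro S _ _ _ i j
    exact ⟨{i}, {j}, by simp, by simp, by simp [prodUpTo], by simp [prodUpTo], by simp⟩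
  | succ s ih =>
    intro S hS hdiag hroot i j
    obtain ⟨A, B, hi, hj, hA, hB, hAB⟩ := ih (fun t => S (t + 1)) (fun t => hS _)
      (fun t => hdiag _) (fun t => hroot _) i j
    obtain ⟨G, ⟨r, hr⟩, hG⟩ := hroot 0
    have step : ∀ {i l m}, p ^ s ≤ prodUpTo n (fun t => S (t + 1)) s i l → p ≤ S 0 l m →
        p ^ (s + 1) ≤ prodUpTo n S (s + 1) i m := by
      intro i l m h₁ h₂
      rw [prodUpTo_succ_right]
      exact pow_succ_le_mul_apply hp (isRowStochastic_prodUpTo (fun t => hS _) s) (hS 0) h₁ h₂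
    have hA' : ∀ l ∈ A, p ^ (s + 1) ≤ prodUpTo n S (s + 1) i l :=
      fun l hl => step (hA l hl) (hdiag 0 l)
    have hB' : ∀ l ∈ B, p ^ (s + 1) ≤ prodUpTo n S (s + 1) j l :=
      fun l hl => step (hB l hl) (hdiag 0 l)
    by_cases hd : Disjoint A B
    · have hcard := hAB hd
      by_cases hrA : r ∈ A
      · obtain ⟨u, w, hu, hw, huw⟩ :=
          exists_arc_into (hr j) (Finset.disjoint_left.1 hd hrA) hj
        refine ⟨A, insert u B, hi, Finset.mem_insert_of_mem hj, hA', ?_, fun _ => ?_⟩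
        · intro l hl
          rcases Finset.mem_insert.1 hl with rfl | hl
          · exact step (hB w hw) (hG _ _ huw)
          · exact hB' l hl
        · rw [Finset.card_insert_of_notMem hu]
          omega
      · obtain ⟨u, w, hu, hw, huw⟩ := exists_arc_into (hr i) hrA hi
        refine ⟨insert u A, B, Finset.mem_insert_of_mem hi, hj, ?_, hB', fun _ => ?_⟩
        · intro l hl
          rcases Finset.mem_insert.1 hl with rfl | hl
          · exact step (hA w hw) (hG _ _ huw)
          · exact hA' l hl
        · rw [Finset.card_insert_of_notMem hu]
          omega
    · exact ⟨A, B, hi, hj, hA', hB', fun h => absurd h hd⟩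

/-- Products of `n` stochastic matrices with rooted graphs and positive diagonals are
scrambling. -/
theorem exists_common_large_column {n : ℕ} {p : ℝ} (hp : 0 < p)
    {S : ℕ → Matrix (Fin n) (Fin n) ℝ} (hS : ∀ t, IsRowStochastic (S t))
    (hdiag : ∀ t i, p ≤ S t i i) (hroot : ∀ t, HasRootedGraph p (S t)) (i j : Fin n) :
    ∃ l, p ^ n ≤ prodUpTo n S n i l ∧ p ^ n ≤ prodUpTo n S n j l := by
  obtain ⟨A, B, -, -, hA, hB, hAB⟩ := exists_large_columns hp n S hS hdiag hroot i j
  by_cases hd : Disjoint A B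
  · have h₁ := hAB hd
    have h₂ := Finset.card_le_univ (A ∪ B)
    rw [Finset.card_union_of_disjoint hd, Fintype.card_fin] at h₂
    omega
  · obtain ⟨l, hlA, hlB⟩ := Finset.not_disjoint_iff.1 hd
    exact ⟨l, hA l hlA, hB l hlB⟩

theorem columnOscLE_prodUpTo_mul {n : ℕ} {p q : ℝ} (hp : 0 < p) (hq : 1 - p ^ n * p ^ n ≤ q)
    (hq0 : 0 ≤ q) {S : ℕ → Matrix (Fin n) (Fin n) ℝ} (hS : ∀ t, IsRowStochastic (S t))
    (hdiag : ∀ t i, p ≤ S t i i) (hroot : ∀ t, HasRootedGraph p (S t)) (j : Fin n) (m : ℕ) :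
    ColumnOscLE (prodUpTo n S (n * m)) j (q ^ m) := by
  induction m with
  | zero =>
    intro a b
    simp only [mul_zero, prodUpTo, Matrix.one_apply, pow_zero]
    split_ifs <;> norm_num
  | succ m ih =>
    intro a b
    obtain ⟨l, ha, hb⟩ := exists_common_large_column hp (S := fun t => S (n * m + t))
      (fun t => hS _) (fun t => hdiag _) (fun t => hroot _) a b
    rw [mul_add, mul_one, prodUpTo_add, pow_succ']
    have hW := isRowStochastic_prodUpTo (S := fun t => S (n * m + t)) (fun t => hS _) n
    refine (hW.mul_sub_mul_le ih a b l).trans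
      (mul_le_mul_of_nonneg_right ?_ (pow_nonneg hq0 m))
    have := mul_le_mul ha hb (pow_nonneg hp.le n) (hW.1 a l)
    linarith

theorem exists_columnOscLE_geometric {n : ℕ} (hn : 1 ≤ n) {p : ℝ} (hp : 0 < p) (hp1 : p ≤ 1)
    {S : ℕ → Matrix (Fin n) (Fin n) ℝ} (hS : ∀ t, IsRowStochastic (S t))
    (hdiag : ∀ t i, p ≤ S t i i) (hroot : ∀ t, HasRootedGraph p (S t)) :
    ∃ c μ : ℝ, 0 ≤ c ∧ 0 ≤ μ ∧ μ < 1 ∧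
      ∀ k j, ColumnOscLE (prodUpTo n S k) j (c * μ ^ k) := by
  have hn0 : n ≠ 0 := by omega
  have hpn : 0 < p ^ n := pow_pos hp n
  have hpn1 : p ^ n ≤ 1 := pow_le_one₀ hp.le hp1
  set q : ℝ := 1 - p ^ n * p ^ n / 2 with hq
  have hq0 : 0 < q := by nlinarith
  have hq1 : q < 1 := by nlinarith
  set μ : ℝ := q ^ ((n : ℝ)⁻¹)
  have hμn : μ ^ n = q := Real.rpow_inv_natCast_pow hq0.le hn0
  have hμ0 : 0 ≤ μ := Real.rpow_nonneg hq0.le _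
  have hμ1 : μ < 1 := Real.rpow_lt_one hq0.le hq1 (by positivity)
  refine ⟨q⁻¹, μ, by positivity, hμ0, hμ1, fun k j => ?_⟩
  have hbound : q ^ (k / n) ≤ q⁻¹ * μ ^ k := by
    rw [inv_mul_eq_div, le_div_iff₀ hq0, ← pow_succ, ← hμn, ← pow_mul]
    refine pow_le_pow_of_le_one hμ0 hμ1.le ?_
    have := Nat.lt_mul_div_succ k (show 0 < n by omega)
    exact this.le
  have hosc := columnOscLE_prodUpTo_mul hp (q := q) (by nlinarith) hq0.le hS hdiag hroot j (k / n)
  intro a b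
  rw [← Nat.div_add_mod k n, prodUpTo_add, Nat.div_add_mod k n]
  set W := prodUpTo n (fun t => S (n * (k / n) + t)) (k % n)
  have hW : IsRowStochastic W := isRowStochastic_prodUpTo (fun t => hS _) _
  have h := hW.mul_sub_mul_le hosc a b a
  have h₁ : (1 - W a a * W b a) * q ^ (k / n) ≤ 1 * q ^ (k / n) := by
    refine mul_le_mul_of_nonneg_right ?_ (by positivity)
    have := mul_nonneg (hW.1 a a) (hW.1 b a)
    linarith
  linarith

theorem stmt9 (n : ℕ) (hn : 1 ≤ n) (p : ℝ) (hp0 : 0 < p) (hp1 : p ≤ 1)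
    (S : ℕ → Matrix (Fin n) (Fin n) ℝ)
    (hnonneg : ∀ t i j, 0 ≤ S t i j)
    (hrow : ∀ t i, ∑ j, S t i j = 1)
    (hdiag : ∀ t i, p ≤ S t i i)
    (hroot : ∀ t, ∃ G : Fin n → Fin n → Prop,
      (∃ i, ∀ j, Relation.ReflTransGen G i j) ∧ (∀ i j, G i j → p ≤ S t j i)) :
    ∃ (v : Fin n → ℝ) (c μ : ℝ), 0 ≤ c ∧ 0 ≤ μ ∧ μ < 1 ∧
      ∀ k, 1 ≤ k → ∀ i j, |prodUpTo n S k i j - v j| ≤ c * μ ^ k := by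
  have hS : ∀ t, IsRowStochastic (S t) := fun t => ⟨hnonneg t, hrow t⟩
  obtain ⟨c, μ, hc, hμ0, hμ1, hosc⟩ := exists_columnOscLE_geometric hn hp0 hp1 hS hdiag hroot
  have hclose : ∀ k s a b j,
      |prodUpTo n S (k + s) a j - prodUpTo n S k b j| ≤ c * μ ^ k := by
    intro k s a b j
    rw [prodUpTo_add]
    exact (isRowStochastic_prodUpTo (fun t => hS _) s).abs_mul_sub_le (hosc k j) a b
  let i₀ : Fin n := ⟨0, hn⟩
  have hlim : ∀ j, ∃ x, Tendsto (fun k => prodUpTo n S k i₀ j) atTop (𝓝 x) := by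
    intro j
    refine cauchySeq_tendsto_of_complete (cauchySeq_of_le_geometric μ c hμ1 fun k => ?_)
    rw [dist_comm, Real.dist_eq]
    exact hclose k 1 i₀ i₀ j
  choose v hv using hlim
  refine ⟨v, c, μ, hc, hμ0, hμ1, fun k _ i j => ?_⟩
  rw [abs_sub_comm]
  refine le_of_tendsto ((hv j).sub_const (prodUpTo n S k i j)).abs ?_
  filter_upwards [eventually_ge_atTop k] with m hm
  obtain ⟨s, rfl⟩ := Nat.exists_eq_add_of_le hm
  exact hclose k s i₀ i j
end

section
/- Let n ≥ 2 and p ∈ (0,1], and let S_1,…,S_{n−1} be n×n row-stochastic matrices such that for each t ∈ {1,…,n−1}: (S_t)_{ii} ≥ p for all i, and there exists a rooted directed graph G_t on the vertex set {1,…,n} such that (S_t)_{ji} ≥ p whenever (i,j) is an arc of G_t. Then the product P = S_{n−1} ⋯ S_2 S_1 satisfies μ(P) ≤ 1 − p^{n−1}; in particular P is a scrambling matrix. -/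
/-- A set that contains a vertex reachable from an outside vertex is entered by an arc. -/
lemma exists_entering_arc {α : Type*} {G : α → α → Prop} {A : Finset α} {r a : α}
    (hr : r ∉ A) (ha : a ∈ A) (h : Relation.ReflTransGen G r a) :
    ∃ u v, u ∉ A ∧ v ∈ A ∧ G u v := by
  induction h with
  | refl => exact absurd ha hr
  | @tail b c _ hbc ih =>
    by_cases hb : b ∈ A
    · exact ih hb
    · exact ⟨b, c, hb, ha, hbc⟩

lemma prodUpTo_nonneg {n : ℕ} {S : ℕ → Matrix (Fin n) (Fin n) ℝ} {m : ℕ}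
    (hS : ∀ t < m, ∀ i j, 0 ≤ S t i j) (i j : Fin n) : 0 ≤ prodUpTo n S m i j := by
  induction m generalizing i j with
  | zero =>
    simp only [prodUpTo, Matrix.one_apply]
    split_ifs <;> norm_num
  | succ m ih =>
    rw [prodUpTo, Matrix.mul_apply]
    exact Finset.sum_nonneg fun k _ =>
      mul_nonneg (hS m m.lt_succ_self i k) (ih (fun t ht => hS t (ht.trans m.lt_succ_self)) k j)

lemma pow_succ_le_prodUpTo_succ {n : ℕ} {S : ℕ → Matrix (Fin n) (Fin n) ℝ} {m : ℕ} {p : ℝ}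
    (hp : 0 ≤ p) (hS : ∀ t < m + 1, ∀ i j, 0 ≤ S t i j) {i l k : Fin n}
    (hil : p ≤ S m i l) (hlk : p ^ m ≤ prodUpTo n S m l k) :
    p ^ (m + 1) ≤ prodUpTo n S (m + 1) i k := by
  have hP := fun l => prodUpTo_nonneg (fun t ht => hS t (ht.trans m.lt_succ_self)) l k
  rw [prodUpTo, Matrix.mul_apply, pow_succ']
  calc p * p ^ m ≤ S m i l * prodUpTo n S m l k :=
        mul_le_mul hil hlk (pow_nonneg hp m) (hp.trans hil)
    _ ≤ ∑ x, S m i x * prodUpTo n S m x k :=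
        Finset.single_le_sum (f := fun x => S m i x * prodUpTo n S m x k)
          (fun x _ => mul_nonneg (hS m m.lt_succ_self i x) (hP x)) (Finset.mem_univ l)

lemma pow_le_prodUpTo_diag {n : ℕ} {S : ℕ → Matrix (Fin n) (Fin n) ℝ} {m : ℕ} {p : ℝ}
    (hp : 0 ≤ p) (hS : ∀ t < m, ∀ i j, 0 ≤ S t i j) (hdiag : ∀ t < m, ∀ i, p ≤ S t i i)
    (i : Fin n) : p ^ m ≤ prodUpTo n S m i i := by
  induction m with
  | zero => simp [prodUpTo]
  | succ m ih =>
    exact pow_succ_le_prodUpTo_succ hp hS (hdiag m m.lt_succ_self i)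
      (ih (fun t ht => hS t (ht.trans m.lt_succ_self))
        (fun t ht => hdiag t (ht.trans m.lt_succ_self)))

/-- Two nonempty vertex sets of total size greater than `n - m` contain rows of the product of
`m` rooted matrices that share a column with large entries: as long as the sets are disjoint, one
of them misses the root of the last graph and can be enlarged by an in-neighbour. -/
lemma exists_common_column {n : ℕ} {S : ℕ → Matrix (Fin n) (Fin n) ℝ} {m : ℕ} {p : ℝ}
    (hp : 0 ≤ p) (hS : ∀ t < m, ∀ i j, 0 ≤ S t i j) (hdiag : ∀ t < m, ∀ i, p ≤ S t i i)
    (hroot : ∀ t < m, ∃ G : Fin n → Fin n → Prop,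
      (∃ i, ∀ j, Relation.ReflTransGen G i j) ∧ (∀ i j, G i j → p ≤ S t j i))
    {A B : Finset (Fin n)} (hA : A.Nonempty) (hB : B.Nonempty)
    (hcard : n < A.card + B.card + m) :
    ∃ k, ∃ a ∈ A, ∃ b ∈ B, p ^ m ≤ prodUpTo n S m a k ∧ p ^ m ≤ prodUpTo n S m b k := by
  induction m generalizing A B with
  | zero =>
    have hnd : ¬ Disjoint A B := by
      intro hd
      have h := Finset.card_le_univ (A ∪ B)
      rw [Finset.card_union_of_disjoint hd, Fintype.card_fin] at h
      omega
    obtain ⟨x, hxA, hxB⟩ := Finset.not_disjoint_iff.1 hnd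
    exact ⟨x, x, hxA, x, hxB, by simp [prodUpTo], by simp [prodUpTo]⟩
  | succ m ih =>
    have lift : ∀ t < m, t < m + 1 := fun t ht => ht.trans m.lt_succ_self
    replace ih := @ih (fun t ht => hS t (lift t ht)) (fun t ht => hdiag t (lift t ht))
      (fun t ht => hroot t (lift t ht))
    obtain ⟨G, ⟨r, hr⟩, hG⟩ := hroot m m.lt_succ_self
    have hstay : ∀ {x k}, p ^ m ≤ prodUpTo n S m x k → p ^ (m + 1) ≤ prodUpTo n S (m + 1) x k :=
      fun {x _} h => pow_succ_le_prodUpTo_succ hp hS (hdiag m m.lt_succ_self x) h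
    have grow : ∀ {A B : Finset (Fin n)}, A.Nonempty → B.Nonempty →
        n < A.card + B.card + (m + 1) → r ∉ A →
        ∃ k, ∃ a ∈ A, ∃ b ∈ B, p ^ (m + 1) ≤ prodUpTo n S (m + 1) a k ∧
          p ^ (m + 1) ≤ prodUpTo n S (m + 1) b k := by
      intro A B ⟨a₀, ha₀⟩ hB hcard hrA
      obtain ⟨u, v, hu, hv, huv⟩ := exists_entering_arc hrA ha₀ (hr a₀)
      obtain ⟨k, a, ha, b, hb, hak, hbk⟩ := ih (A := insert u A) (B := B)
        (Finset.insert_nonempty u A) hB (by rw [Finset.card_insert_of_notMem hu]; omega)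
      rcases Finset.mem_insert.1 ha with rfl | ha
      · exact ⟨k, v, hv, b, hb, pow_succ_le_prodUpTo_succ hp hS (hG _ _ huv) hak, hstay hbk⟩
      · exact ⟨k, a, ha, b, hb, hstay hak, hstay hbk⟩
    by_cases hrA : r ∈ A
    · by_cases hrB : r ∈ B
      · have h := pow_le_prodUpTo_diag hp hS hdiag r
        exact ⟨r, r, hrA, r, hrB, h, h⟩
      · obtain ⟨k, b, hb, a, ha, hbk, hak⟩ := grow hB hA (by omega) hrB
        exact ⟨k, a, ha, b, hb, hak, hbk⟩
    · exact grow hA hB hcard hrA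

theorem stmt10 (n : ℕ) (hn : 2 ≤ n) (p : ℝ) (hp0 : 0 < p) (hp1 : p ≤ 1)
    (S : ℕ → Matrix (Fin n) (Fin n) ℝ)
    (hnonneg : ∀ t < n - 1, ∀ i j, 0 ≤ S t i j)
    (hrow : ∀ t < n - 1, ∀ i, ∑ j, S t i j = 1)
    (hdiag : ∀ t < n - 1, ∀ i, p ≤ S t i i)
    (hroot : ∀ t < n - 1, ∃ G : Fin n → Fin n → Prop,
      (∃ i, ∀ j, Relation.ReflTransGen G i j) ∧ (∀ i j, G i j → p ≤ S t j i)) :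
    (∀ i j : Fin n,
        1 - ∑ k, min (prodUpTo n S (n - 1) i k) (prodUpTo n S (n - 1) j k)
          ≤ 1 - p ^ (n - 1)) ∧
      (∀ i j : Fin n,
        1 - ∑ k, min (prodUpTo n S (n - 1) i k) (prodUpTo n S (n - 1) j k) < 1) := by
  have key : ∀ i j : Fin n,
      p ^ (n - 1) ≤ ∑ k, min (prodUpTo n S (n - 1) i k) (prodUpTo n S (n - 1) j k) := by
    intro i j
    obtain ⟨k, a, ha, b, hb, hak, hbk⟩ := exists_common_column hp0.le hnonneg hdiag hroot
      (Finset.singleton_nonempty i) (Finset.singleton_nonempty j)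
      (by simp only [Finset.card_singleton]; omega)
    rw [Finset.mem_singleton] at ha hb
    subst ha hb
    exact (le_min hak hbk).trans (Finset.single_le_sum
      (f := fun k => min (prodUpTo n S (n - 1) a k) (prodUpTo n S (n - 1) b k))
      (fun k _ => le_min (prodUpTo_nonneg hnonneg a k) (prodUpTo_nonneg hnonneg b k))
      (Finset.mem_univ k))
  exact ⟨fun i j => sub_le_sub_left (key i j) 1,
    fun i j => sub_lt_self 1 ((pow_pos hp0 _).trans_le (key i j))⟩
end

section
/- Consider the dynamics described in the context, with H ≥ 1 agents, states x_i(t) ∈ ℝ^d, row-stochastic matrices W(t), absolute probability sequence π(t), geometric ergodicity constant λ ∈ (0,1), disturbance bound D ≥ 0, and stepsizes α(t) that are positive, non-increasing, with Σ_t α(t) = ∞ and Σ_t α(t)² < ∞. Then for every agent i, ‖x_i(t) − y(t)‖ → 0 as t → ∞, where y(t) = Σ_{i=1}^H π_i(t) x_i(t). -/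
open Filter

/-- `backProd H W τ m = W (τ + m) * ⋯ * W (τ + 1) * W τ`, the backward product
`[W(t) W(t-1) ⋯ W(τ)]` with `t = τ + m`. -/
def backProd (H : ℕ) (W : ℕ → Matrix (Fin H) (Fin H) ℝ) (τ : ℕ) :
    ℕ → Matrix (Fin H) (Fin H) ℝ
  | 0 => W τ
  | m + 1 => W (τ + m + 1) * backProd H W τ m

theorem tendsto_zero_of_contracting_shift {a b : ℕ → ℝ} {N : ℕ} (hN : 0 < N)
    (ha : ∀ t, 0 ≤ a t) (hb : Tendsto b atTop (nhds 0))
    (hab : ∀ t, a (t + N) ≤ a t / 2 + b t) : Tendsto a atTop (nhds 0) := by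
  rw [Metric.tendsto_atTop]
  intro ε hε
  obtain ⟨T, hT⟩ := eventually_atTop.1
    (hb.eventually (ge_mem_nhds (show (0 : ℝ) < ε / 4 by linarith)))
  set M := ∑ r ∈ Finset.range N, a (T + r)
  have hM : ∀ r < N, a (T + r) ≤ M := fun r hr =>
    Finset.single_le_sum (f := fun r => a (T + r)) (fun r _ => ha _) (Finset.mem_range.2 hr)
  have key : ∀ k r, r < N → a (T + r + k * N) ≤ M * (1 / 2) ^ k + ε / 2 := by
    intro k r hr
    induction k with
    | zero => simpa using (hM r hr).trans (by linarith)
    | succ k ih =>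
      have h := hab (T + r + k * N)
      have h' := hT (T + r + k * N) (by rw [add_assoc]; exact Nat.le_add_right _ _)
      rw [show T + r + (k + 1) * N = T + r + k * N + N by ring, pow_succ]
      linarith
  have hlim : Tendsto (fun k : ℕ => M * (1 / 2 : ℝ) ^ k) atTop (nhds 0) := by
    simpa using (tendsto_pow_atTop_nhds_zero_of_lt_one (r := (1 / 2 : ℝ))
      (by norm_num) (by norm_num)).const_mul M
  obtain ⟨K, hK⟩ := eventually_atTop.1 (hlim.eventually (gt_mem_nhds (half_pos hε)))
  refine ⟨T + K * N, fun t ht => ?_⟩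
  have hk : K ≤ (t - T) / N := (Nat.le_div_iff_mul_le hN).2 (by omega)
  have h1 := key ((t - T) / N) ((t - T) % N) (Nat.mod_lt _ hN)
  have h2 := hK _ hk
  have h3 : T + (t - T) % N + (t - T) / N * N = t := by
    have := Nat.mod_add_div' (t - T) N
    omega
  rw [h3] at h1
  rw [Real.dist_0_eq_abs, abs_of_nonneg (ha t)]
  linarith

theorem norm_sum_smul_le_of_stochastic {ι E : Type*} [Fintype ι] [SeminormedAddCommGroup E]
    [NormedSpace ℝ E] {w : ι → ℝ} {z : ι → E} {c : ℝ} (hw : ∀ i, 0 ≤ w i)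
    (hsum : ∑ i, w i = 1) (hz : ∀ i, ‖z i‖ ≤ c) : ‖∑ i, w i • z i‖ ≤ c :=
  calc ‖∑ i, w i • z i‖ ≤ ∑ i, w i * c := norm_sum_le_of_le _ fun i _ => by
        rw [norm_smul, Real.norm_of_nonneg (hw i)]
        exact mul_le_mul_of_nonneg_left (hz i) (hw i)
    _ = c := by rw [← Finset.sum_mul, hsum, one_mul]

theorem sum_backProd_row {H : ℕ} {W : ℕ → Matrix (Fin H) (Fin H) ℝ}
    (hWrow : ∀ t i, ∑ j, W t i j = 1) (τ m : ℕ) (i : Fin H) :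
    ∑ j, backProd H W τ m i j = 1 := by
  induction m generalizing i with
  | zero => exact hWrow τ i
  | succ m ih =>
    simp only [backProd, Matrix.mul_apply]
    rw [Finset.sum_comm]
    simp_rw [← Finset.mul_sum, ih, mul_one, hWrow]

section Dynamics

variable {H : ℕ} {E : Type*} [NormedAddCommGroup E] [NormedSpace ℝ E] {D : ℝ}
  {W : ℕ → Matrix (Fin H) (Fin H) ℝ} {x u : ℕ → Fin H → E} {p : ℕ → Fin H → ℝ} {α : ℕ → ℝ}

theorem norm_step_smul_le (hu : ∀ t i, ‖u t i‖ ≤ D) (hαpos : ∀ t, 0 < α t)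
    (hα : Antitone α) {τ t : ℕ} (h : τ ≤ t) (i : Fin H) : ‖α t • u t i‖ ≤ α τ * D := by
  rw [norm_smul, Real.norm_of_nonneg (hαpos t).le]
  exact mul_le_mul (hα h) (hu t i) (norm_nonneg _) (hαpos τ).le

theorem norm_state_sub_backProd_le (hWnonneg : ∀ t i j, 0 ≤ W t i j)
    (hWrow : ∀ t i, ∑ j, W t i j = 1) (hu : ∀ t i, ‖u t i‖ ≤ D)
    (hdyn : ∀ t i, x (t + 1) i = (∑ j, W t i j • x t j) - α t • u t i)
    (hαpos : ∀ t, 0 < α t) (hα : Antitone α) (τ m : ℕ) (i : Fin H) :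
    ‖x (τ + m + 1) i - ∑ j, backProd H W τ m i j • x τ j‖ ≤ (m + 1) * (α τ * D) := by
  induction m generalizing i with
  | zero =>
    simpa [hdyn, backProd] using norm_step_smul_le hu hαpos hα le_rfl i
  | succ m ih =>
    have e : x (τ + (m + 1) + 1) i - ∑ j, backProd H W τ (m + 1) i j • x τ j =
        (∑ k, W (τ + m + 1) i k • (x (τ + m + 1) k - ∑ j, backProd H W τ m k j • x τ j)) -
          α (τ + m + 1) • u (τ + m + 1) i := by
      rw [hdyn]
      simp only [backProd, Matrix.mul_apply, smul_sub, Finset.sum_sub_distrib, Finset.smul_sum,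
        Finset.sum_smul, mul_smul, ← add_assoc]
      rw [Finset.sum_comm (f := fun k j => W (τ + m + 1) i k • backProd H W τ m k j • x τ j)]
      abel
    rw [e]
    refine (norm_sub_le _ _).trans ?_
    have h1 := norm_sum_smul_le_of_stochastic (hWnonneg (τ + m + 1) i) (hWrow _ i) ih
    have h2 := norm_step_smul_le hu hαpos hα (show τ ≤ τ + m + 1 by omega) i
    push_cast
    linarith

theorem norm_average_sub_le (hu : ∀ t i, ‖u t i‖ ≤ D)
    (hdyn : ∀ t i, x (t + 1) i = (∑ j, W t i j • x t j) - α t • u t i)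
    (hp : ∀ t i, 0 ≤ p t i) (hpsum : ∀ t, ∑ i, p t i = 1)
    (hpW : ∀ t j, p t j = ∑ i, p (t + 1) i * W t i j)
    (hαpos : ∀ t, 0 < α t) (hα : Antitone α) (τ m : ℕ) :
    ‖∑ j, p (τ + m) j • x (τ + m) j - ∑ j, p τ j • x τ j‖ ≤ m * (α τ * D) := by
  induction m with
  | zero => simp
  | succ m ih =>
    have e : ∑ j, p (τ + (m + 1)) j • x (τ + (m + 1)) j =
        ∑ j, p (τ + m) j • x (τ + m) j -
          ∑ j, p (τ + m + 1) j • α (τ + m) • u (τ + m) j := by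
      simp only [← add_assoc, hdyn, smul_sub, Finset.sum_sub_distrib, Finset.smul_sum,
        hpW (τ + m), Finset.sum_smul, mul_smul]
      rw [Finset.sum_comm]
    rw [e, sub_right_comm]
    refine (norm_sub_le _ _).trans ?_
    have h := norm_sum_smul_le_of_stochastic (hp (τ + m + 1)) (hpsum _)
      (fun j => norm_step_smul_le hu hαpos hα (show τ ≤ τ + m by omega) j)
    push_cast
    linarith

end Dynamics

theorem stmt11 (H d : ℕ) (hH : 1 ≤ H) (hd : 1 ≤ d) (D : ℝ) (hD : 0 ≤ D)
    (lam : ℝ) (hlam0 : 0 < lam) (hlam1 : lam < 1)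
    (W : ℕ → Matrix (Fin H) (Fin H) ℝ)
    (x u : ℕ → Fin H → EuclideanSpace ℝ (Fin d))
    (pivec : ℕ → Fin H → ℝ) (α : ℕ → ℝ)
    (hWnonneg : ∀ t i j, 0 ≤ W t i j)
    (hWrow : ∀ t i, ∑ j, W t i j = 1)
    (hu : ∀ t i, ‖u t i‖ ≤ D)
    (hdyn : ∀ t i, x (t + 1) i = (∑ j, W t i j • x t j) - α t • u t i)
    (hpinonneg : ∀ t i, 0 ≤ pivec t i)
    (hpisum : ∀ t, ∑ i, pivec t i = 1)
    (hpiaps : ∀ t j, pivec t j = ∑ i, pivec (t + 1) i * W t i j)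
    (hPhi : ∀ τ m i j, |backProd H W τ m i j - pivec τ j| ≤ 2 * lam ^ m)
    (hαpos : ∀ t, 0 < α t) (hαmono : ∀ t, α (t + 1) ≤ α t)
    (hαdiv : ¬ Summable α) (hαsq : Summable fun t => (α t) ^ 2) :
    ∀ i, Tendsto (fun t => ‖x t i - ∑ j, pivec t j • x t j‖) atTop (nhds 0) := by
  set y : ℕ → EuclideanSpace ℝ (Fin d) := fun t => ∑ j, pivec t j • x t j with hy
  have hα : Antitone α := antitone_nat_of_succ_le hαmono
  have hα0 : Tendsto α atTop (nhds 0) := by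
    have h := (Real.continuous_sqrt.tendsto 0).comp hαsq.tendsto_atTop_zero
    rw [Real.sqrt_zero] at h
    exact h.congr fun t => Real.sqrt_sq (hαpos t).le
  obtain ⟨m, hm⟩ : ∃ m : ℕ, H * (2 * lam ^ m) ≤ 1 / 2 := by
    have h :=
      (tendsto_pow_atTop_nhds_zero_of_lt_one hlam0.le hlam1).const_mul 2 |>.const_mul (H : ℝ)
    simp only [mul_zero] at h
    exact (h.eventually (ge_mem_nhds (by norm_num))).exists
  have step : ∀ t i, ‖x (t + (m + 1)) i - y (t + (m + 1))‖ ≤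
      2 * lam ^ m * ∑ j, ‖x t j - y t‖ + 2 * ((m + 1) * (α t * D)) := by
    intro t i
    have e : ∑ j, backProd H W t m i j • x t j - y t =
        ∑ j, (backProd H W t m i j - pivec t j) • (x t j - y t) := by
      have h0 : ∑ j, (backProd H W t m i j - pivec t j) • y t = 0 := by
        rw [← Finset.sum_smul, Finset.sum_sub_distrib, sum_backProd_row hWrow, hpisum, sub_self,
          zero_smul]
      simp only [smul_sub, Finset.sum_sub_distrib, h0, sub_zero]
      simp only [sub_smul, Finset.sum_sub_distrib, hy]
    have h1 : ‖∑ j, backProd H W t m i j • x t j - y t‖ ≤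
        2 * lam ^ m * ∑ j, ‖x t j - y t‖ := by
      rw [e, Finset.mul_sum]
      refine norm_sum_le_of_le _ fun j _ => ?_
      rw [norm_smul]
      exact mul_le_mul_of_nonneg_right (hPhi t m i j) (norm_nonneg _)
    have h2 := norm_state_sub_backProd_le hWnonneg hWrow hu hdyn hαpos hα t m i
    have h3 := norm_average_sub_le hu hdyn hpinonneg hpisum hpiaps hαpos hα t (m + 1)
    change ‖y (t + (m + 1)) - y t‖ ≤ _ at h3
    push_cast at h3
    rw [← sub_add_sub_cancel _ (∑ j, backProd H W t m i j • x t j),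
      ← sub_sub_sub_cancel_right _ (y (t + (m + 1))) (y t)]
    have h4 := norm_sub_le (∑ j, backProd H W t m i j • x t j - y t) (y (t + (m + 1)) - y t)
    refine (norm_add_le _ _).trans ?_
    rw [add_assoc] at h2
    linarith
  have hS : Tendsto (fun t => ∑ j, ‖x t j - y t‖) atTop (nhds 0) := by
    refine tendsto_zero_of_contracting_shift (N := m + 1)
      (b := fun t => H * (2 * ((m + 1) * (α t * D)))) m.succ_pos
      (fun t => Finset.sum_nonneg fun j _ => norm_nonneg _) ?_ fun t => ?_
    · simpa using (((hα0.mul_const D).const_mul ((m : ℝ) + 1)).const_mul 2).const_mul (H : ℝ)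
    · have h := Finset.sum_le_sum fun i (_ : i ∈ Finset.univ) => step t i
      rw [Finset.sum_const, Finset.card_univ, Fintype.card_fin, nsmul_eq_mul] at h
      have h' := mul_le_mul_of_nonneg_right hm
        (Finset.sum_nonneg fun j (_ : j ∈ Finset.univ) => norm_nonneg (x t j - y t))
      linarith
  intro i
  exact squeeze_zero (fun t => norm_nonneg _) (fun t => Finset.single_le_sum
    (f := fun j => ‖x t j - y t‖) (fun j _ => norm_nonneg _) (Finset.mem_univ i)) hS
end

section
/- Consider the dynamics described in the context, with H ≥ 1 agents, states x_i(t) ∈ ℝ^d, row-stochastic matrices W(t), absolute probability sequence π(t), geometric ergodicity constant λ ∈ (0,1), disturbance bound D ≥ 0, and stepsizes α(t) that are positive, non-increasing, with Σ_t α(t) = ∞ and Σ_t α(t)² < ∞. Then for every agent i, Σ_{t=0}^∞ α(t) ‖x_i(t) − y(t)‖ < ∞, where y(t) = Σ_{i=1}^H π_i(t) x_i(t). -/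
open Filter

/-- A nonnegative sequence contracted at each step up to a summable perturbation is summable. -/
theorem summable_of_succ_le_mul_add {a c : ℕ → ℝ} {r : ℝ} (hr1 : r < 1)
    (ha : ∀ n, 0 ≤ a n) (hc : ∀ n, 0 ≤ c n) (hcs : Summable c)
    (h : ∀ n, a (n + 1) ≤ r * a n + c n) : Summable a := by
  have h1r : 0 < 1 - r := sub_pos.2 hr1
  refine summable_of_sum_range_le (c := (a 0 + ∑' n, c n) / (1 - r)) ha fun n => ?_
  have hstep : ∑ k ∈ Finset.range (n + 1), a k
      ≤ a 0 + (r * ∑ k ∈ Finset.range n, a k + ∑ k ∈ Finset.range n, c k) := by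
    rw [Finset.sum_range_succ', add_comm, Finset.mul_sum, ← Finset.sum_add_distrib]
    gcongr with k
    exact h k
  have hsum : ∑ k ∈ Finset.range n, c k ≤ ∑' n, c n := hcs.sum_le_tsum _ fun k _ => hc k
  rw [Finset.sum_range_succ] at hstep
  rw [le_div_iff₀ h1r]
  linarith [ha n]

theorem norm_sum_smul_le {ι E : Type*} [Fintype ι] [SeminormedAddCommGroup E] [NormedSpace ℝ E]
    {p : ι → ℝ} {v : ι → E} {C : ℝ} (hp : ∀ j, |p j| ≤ C) :
    ‖∑ j, p j • v j‖ ≤ C * ∑ j, ‖v j‖ := by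
  rw [Finset.mul_sum]
  refine norm_sum_le_of_le _ fun j _ => ?_
  rw [norm_smul, Real.norm_eq_abs]
  exact mul_le_mul_of_nonneg_right (hp j) (norm_nonneg _)

/-- The product `W (τ + m - 1) * ⋯ * W τ` of `m` matrices, with the empty product allowed. -/
def transition (H : ℕ) (W : ℕ → Matrix (Fin H) (Fin H) ℝ) :
    ℕ → ℕ → Matrix (Fin H) (Fin H) ℝ
  | _, 0 => 1
  | τ, m + 1 => transition H W (τ + 1) m * W τ

theorem backProd_succ' (H : ℕ) (W : ℕ → Matrix (Fin H) (Fin H) ℝ) (τ m : ℕ) :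
    backProd H W τ (m + 1) = backProd H W (τ + 1) m * W τ := by
  induction m with
  | zero => rfl
  | succ m ih =>
    rw [backProd, ih, backProd, Matrix.mul_assoc,
      show τ + (m + 1) + 1 = τ + 1 + m + 1 by omega]

theorem transition_succ (H : ℕ) (W : ℕ → Matrix (Fin H) (Fin H) ℝ) (τ m : ℕ) :
    transition H W τ (m + 1) = backProd H W τ m := by
  induction m generalizing τ with
  | zero => simp [transition, backProd]
  | succ m ih => rw [transition, ih, backProd_succ']

theorem abs_transition_sub_le {H : ℕ} {W : ℕ → Matrix (Fin H) (Fin H) ℝ} {p : ℕ → Fin H → ℝ}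
    {r : ℝ} (hr0 : 0 < r) (hr1 : r < 1) (hp0 : ∀ t i, 0 ≤ p t i) (hp1 : ∀ t, ∑ i, p t i = 1)
    (h : ∀ τ m i j, |backProd H W τ m i j - p τ j| ≤ 2 * r ^ m) (τ m : ℕ) (i j : Fin H) :
    |transition H W τ m i j - p τ j| ≤ 2 / r * r ^ m := by
  cases m with
  | zero =>
    have hpj : p τ j ≤ 1 := by
      rw [← hp1 τ]
      exact Finset.single_le_sum (fun k _ => hp0 τ k) (Finset.mem_univ j)
    have h2 : 1 ≤ 2 / r := by rw [le_div_iff₀ hr0]; linarith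
    have h0 := hp0 τ j
    rw [transition, Matrix.one_apply, abs_le]
    split_ifs <;> constructor <;> simp only [pow_zero] <;> linarith
  | succ m =>
    rw [transition_succ]
    refine (h τ m i j).trans_eq ?_
    field_simp
    ring

theorem stmt13 (H d : ℕ) (hH : 1 ≤ H) (hd : 1 ≤ d) (D : ℝ) (hD : 0 ≤ D)
    (lam : ℝ) (hlam0 : 0 < lam) (hlam1 : lam < 1)
    (W : ℕ → Matrix (Fin H) (Fin H) ℝ)
    (x u : ℕ → Fin H → EuclideanSpace ℝ (Fin d))
    (pivec : ℕ → Fin H → ℝ) (α : ℕ → ℝ)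
    (hWnonneg : ∀ t i j, 0 ≤ W t i j)
    (hWrow : ∀ t i, ∑ j, W t i j = 1)
    (hu : ∀ t i, ‖u t i‖ ≤ D)
    (hdyn : ∀ t i, x (t + 1) i = (∑ j, W t i j • x t j) - α t • u t i)
    (hpinonneg : ∀ t i, 0 ≤ pivec t i)
    (hpisum : ∀ t, ∑ i, pivec t i = 1)
    (hpiaps : ∀ t j, pivec t j = ∑ i, pivec (t + 1) i * W t i j)
    (hPhi : ∀ τ m i j, |backProd H W τ m i j - pivec τ j| ≤ 2 * lam ^ m)
    (hαpos : ∀ t, 0 < α t) (hαmono : ∀ t, α (t + 1) ≤ α t)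
    (hαdiv : ¬ Summable α) (hαsq : Summable fun t => (α t) ^ 2) :
    ∀ i, Summable fun t => α t * ‖x t i - ∑ j, pivec t j • x t j‖ := by
  intro i
  set C : ℝ := 2 / lam
  have hC : 0 ≤ C := by positivity
  have hΦ := abs_transition_sub_le hlam0 hlam1 hpinonneg hpisum hPhi
  let K : ℝ := C * (H * D)
  have hK : 0 ≤ K := by positivity
  let b : ℕ → ℝ := fun t => Nat.rec (C * ∑ j, ‖x 0 j‖) (fun s y => lam * y + K * α s) t
  have hb_succ (t : ℕ) : b (t + 1) = lam * b t + K * α t := rfl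
  have hb0 (t : ℕ) : 0 ≤ b t := by
    induction t with
    | zero => exact mul_nonneg hC (Finset.sum_nonneg fun j _ => norm_nonneg _)
    | succ t ih =>
      rw [hb_succ]
      have := hαpos t
      positivity
  have hstep (t m : ℕ) :
      ∑ j, (transition H W (t + 1) m i j - pivec (t + 1) j) • x (t + 1) j
        = ∑ j, (transition H W t (m + 1) i j - pivec t j) • x t j
          - α t • ∑ j, (transition H W (t + 1) m i j - pivec (t + 1) j) • u t j := by
    simp only [hdyn, smul_sub, Finset.sum_sub_distrib, Finset.smul_sum, smul_smul]
    congr 1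
    · rw [Finset.sum_comm]
      refine Finset.sum_congr rfl fun k _ => ?_
      rw [← Finset.sum_smul, transition, Matrix.mul_apply, hpiaps t k, ← Finset.sum_sub_distrib]
      simp only [sub_mul]
    · simp only [mul_comm]
  have hbound (t : ℕ) : ∀ m,
      ‖∑ j, (transition H W t m i j - pivec t j) • x t j‖ ≤ lam ^ m * b t := by
    induction t with
    | zero =>
      intro m
      refine (norm_sum_smul_le (hΦ 0 m i)).trans_eq ?_
      change C * lam ^ m * _ = lam ^ m * (C * _)
      ring
    | succ t ih =>
      intro m
      rw [hstep]
      have hu' : ∑ j, ‖u t j‖ ≤ H * D := by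
        simpa using Finset.sum_le_card_nsmul Finset.univ (fun j => ‖u t j‖) D fun j _ => hu t j
      calc _ ≤ lam ^ (m + 1) * b t + α t * (C * lam ^ m * (H * D)) := by
            refine (norm_sub_le _ _).trans (add_le_add (ih _) ?_)
            rw [norm_smul, Real.norm_of_nonneg (hαpos t).le]
            refine mul_le_mul_of_nonneg_left ?_ (hαpos t).le
            exact (norm_sum_smul_le (hΦ (t + 1) m i)).trans
              (mul_le_mul_of_nonneg_left hu' (by positivity))
        _ = lam ^ m * b (t + 1) := by
            rw [hb_succ]
            simp only [K]
            ring
  have hsum : Summable fun t => α t * b t := by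
    refine summable_of_succ_le_mul_add hlam1 (fun t => mul_nonneg (hαpos t).le (hb0 t))
      (fun t => mul_nonneg hK (sq_nonneg _)) (hαsq.mul_left K) fun t => ?_
    calc α (t + 1) * b (t + 1) ≤ α t * b (t + 1) :=
          mul_le_mul_of_nonneg_right (hαmono t) (hb0 (t + 1))
      _ = lam * (α t * b t) + K * α t ^ 2 := by rw [hb_succ]; ring
  refine hsum.of_nonneg_of_le (fun t => mul_nonneg (hαpos t).le (norm_nonneg _)) fun t => ?_
  refine mul_le_mul_of_nonneg_left ?_ (hαpos t).le
  simpa [transition, sub_smul, Finset.sum_sub_distrib, Matrix.one_apply] using hbound t 0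
end

section
/- Let H ≥ 2 and 1 ≤ κ ≤ H be integers, let V be a set of H vertices, set l = (H − κ + 1)(H − 2) + 1, and let G_1,…,G_l be directed graphs on V, each having at least κ roots. Then there exists a subset S ⊆ V with |S| ≥ κ such that every vertex i ∈ S is a root of at least H − 1 of the graphs G_1,…,G_l. -/
open Classical in
/-- Double counting: if each of `l = (H - κ + 1) * (H - 2) + 1` indices is related to at least `κ`
of `H` vertices, then at least `κ` vertices are related to at least `H - 1` indices. -/
theorem le_card_filter_of_forall_le_card {H κ l : ℕ} (hH : 2 ≤ H) (hκH : κ ≤ H)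
    (hl : l = (H - κ + 1) * (H - 2) + 1) {V : Type*} [Fintype V] (hV : Fintype.card V = H)
    (R : Fin l → V → Prop) (hR : ∀ t, κ ≤ (Finset.univ.filter fun i => R t i).card) :
    κ ≤ (Finset.univ.filter fun i =>
      H - 1 ≤ (Finset.univ.filter fun t => R t i).card).card := by
  by_contra! hlt
  set S := Finset.univ.filter fun i => H - 1 ≤ (Finset.univ.filter fun t => R t i).card with hS
  have hcount : ∑ t, (Finset.univ.filter fun i => R t i).card
      = ∑ i, (Finset.univ.filter fun t => R t i).card :=
    Finset.sum_card_bipartiteAbove_eq_sum_card_bipartiteBelow R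
  have hlower : l * κ ≤ ∑ t, (Finset.univ.filter fun i => R t i).card := by
    simpa using Finset.card_nsmul_le_sum Finset.univ _ κ fun t _ => hR t
  have hgood : ∑ i ∈ S, (Finset.univ.filter fun t => R t i).card ≤ S.card * l := by
    refine Finset.sum_le_card_nsmul S _ l fun i _ => ?_
    simpa using Finset.card_le_univ (Finset.univ.filter fun t => R t i)
  have hbad : ∑ i ∈ Sᶜ, (Finset.univ.filter fun t => R t i).card ≤ Sᶜ.card * (H - 2) := by
    refine Finset.sum_le_card_nsmul Sᶜ _ (H - 2) fun i hi => ?_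
    simp only [hS, Finset.mem_compl, Finset.mem_filter, Finset.mem_univ, true_and] at hi
    omega
  have hsplit := Finset.sum_add_sum_compl S fun i => (Finset.univ.filter fun t => R t i).card
  have hcompl : S.card + Sᶜ.card = H := by rw [Finset.card_add_card_compl, hV]
  have htotal : l * κ ≤ S.card * l + Sᶜ.card * (H - 2) := by omega
  obtain ⟨d, hd⟩ := Nat.exists_eq_add_of_lt hlt
  have hc : Sᶜ.card = (H - κ + 1) + d := by omega
  rw [hc, hd] at htotal
  have hle : H - 2 ≤ l := by rw [hl]; nlinarith [Nat.zero_le ((H - κ) * (H - 2))]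
  nlinarith [Nat.mul_le_mul_left d hle]

theorem stmt14 (H κ : ℕ) (hH : 2 ≤ H) (hκ1 : 1 ≤ κ) (hκH : κ ≤ H)
    (V : Type*) [Fintype V] (hV : Fintype.card V = H)
    (G : Fin ((H - κ + 1) * (H - 2) + 1) → V → V → Prop)
    (hroots : ∀ t, κ ≤ {i : V | ∀ j, Relation.ReflTransGen (G t) i j}.ncard) :
    ∃ S : Set V, κ ≤ S.ncard ∧
      ∀ i ∈ S,
        H - 1 ≤ {t : Fin ((H - κ + 1) * (H - 2) + 1) |
          ∀ j, Relation.ReflTransGen (G t) i j}.ncard := by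
  classical
  simp only [Set.ncard_eq_toFinset_card', Set.toFinset_ofPred] at hroots
  refine ⟨{i | H - 1 ≤ {t | ∀ j, Relation.ReflTransGen (G t) i j}.ncard}, ?_, fun i hi => hi⟩
  simp only [Set.ncard_eq_toFinset_card', Set.toFinset_ofPred]
  convert le_card_filter_of_forall_le_card hH hκH rfl hV
    (fun t i => ∀ j, Relation.ReflTransGen (G t) i j) (fun t => by convert hroots t)
end

section
/- Let H ≥ 2 and 1 ≤ κ ≤ H be integers, η ∈ (0,1], and set l = (H − κ + 1)(H − 2) + 1. Let {W(t)}, t = 0,1,2,…, be H×H row-stochastic matrices such that for each t: (W(t))_{ii} ≥ η for all i, and there exists a directed graph G_t on {1,…,H}, with self-loops at all vertices, having at least κ roots, such that (W(t))_{ji} ≥ η whenever (i,j) is an arc of G_t. Let {π(t)} be a sequence of stochastic vectors such that for all τ ≥ 0 and all i,j, [W(t)W(t−1)⋯W(τ)]_{ij} → π_j(τ) as t → ∞. Then for every τ ≥ 0 there exists a subset S ⊆ {1,…,H} with |S| ≥ κ such that π_j(τ) ≥ η^l for all j ∈ S. -/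
open Filter

open Finset in
/-- If each of the `n` finite sets `R t` has at least `κ` elements, then at least `κ` points lie in
more than `d` of them, as soon as `n > (card α - κ + 1) * d`. -/
theorem le_card_filter_lt_card_of_lt {α : Type*} [Fintype α] [DecidableEq α] {κ d n : ℕ}
    (hκα : κ ≤ Fintype.card α) (R : ℕ → Finset α) (hR : ∀ t, κ ≤ (R t).card)
    (hn : (Fintype.card α - κ + 1) * d < n) :
    κ ≤ (univ.filter fun j => d < ((range n).filter fun t => j ∈ R t).card).card := by
  set c : α → ℕ := fun j => ((range n).filter fun t => j ∈ R t).card with hc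
  set S := univ.filter fun j => d < c j with hS
  by_contra! hlt
  have hsum : ∑ j, c j = ∑ t ∈ range n, (R t).card := by
    have := sum_card_bipartiteAbove_eq_sum_card_bipartiteBelow
      (s := (univ : Finset α)) (t := range n) (fun j t => j ∈ R t)
    simpa [bipartiteAbove, bipartiteBelow, hc] using this
  have hlow : n * κ ≤ ∑ j, c j := by
    rw [hsum]
    simpa using card_nsmul_le_sum (range n) (fun t => (R t).card) κ fun t _ => hR t
  have hcn : ∀ j, c j ≤ n := fun j => by simpa using card_filter_le (range n) fun t => j ∈ R t
  have hin : ∑ j ∈ S, c j ≤ S.card * n := sum_le_card_nsmul _ _ _ fun j _ => hcn j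
  have hout : ∑ j ∈ Sᶜ, c j ≤ Sᶜ.card * d :=
    sum_le_card_nsmul _ _ _ fun j hj => by simpa [hS] using hj
  have hsplit := sum_add_sum_compl S c
  have hcard := card_add_card_compl S
  obtain ⟨a, ha⟩ : ∃ a, κ = S.card + 1 + a := ⟨κ - (S.card + 1), by omega⟩
  obtain ⟨b, hb⟩ : ∃ b, Fintype.card α = κ + b := ⟨Fintype.card α - κ, by omega⟩
  have hC : Sᶜ.card = b + 1 + a := by omega
  have hb' : Fintype.card α - κ = b := by omega
  have hdn : d ≤ n := by nlinarith
  rw [hC] at hout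
  rw [hb'] at hn
  rw [ha] at hlow
  nlinarith [Nat.mul_le_mul_left a hdn]

/-- A set containing a root, but not all vertices, is left by some arc. -/
theorem exists_arc_leaving {α : Type*} {G : α → α → Prop} {j : α}
    (hroot : ∀ i, Relation.ReflTransGen G j i) {A : Set α} (hj : j ∈ A) (hA : A ≠ Set.univ) :
    ∃ r ∈ A, ∃ i ∉ A, G r i := by
  by_contra! h
  refine hA (Set.eq_univ_of_forall fun i => ?_)
  induction hroot i with
  | refl => exact hj
  | tail _ hbc ih => exact by_contra fun hc => h _ ih _ hc hbc

/-- The left product `V (m - 1) * ⋯ * V 0`. -/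
def leftProd {α : Type*} [Fintype α] [DecidableEq α] (V : ℕ → Matrix α α ℝ) : ℕ → Matrix α α ℝ
  | 0 => 1
  | m + 1 => V m * leftProd V m

theorem backProd_eq_leftProd (H : ℕ) (W : ℕ → Matrix (Fin H) (Fin H) ℝ) (τ m : ℕ) :
    backProd H W τ m = leftProd (fun k => W (τ + k)) (m + 1) := by
  induction m with
  | zero => simp [backProd, leftProd]
  | succ m ih => rw [backProd, ih]; rfl

section LeftProd

variable {α : Type*} [Fintype α] [DecidableEq α] {V : ℕ → Matrix α α ℝ}

theorem leftProd_nonneg (hV : ∀ t i j, 0 ≤ V t i j) (m : ℕ) (i j : α) : 0 ≤ leftProd V m i j := by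
  induction m generalizing i with
  | zero =>
    simp only [leftProd, Matrix.one_apply]
    split_ifs <;> norm_num
  | succ m ih => exact Finset.sum_nonneg fun r _ => mul_nonneg (hV m i r) (ih r)

theorem pow_succ_le_leftProd_succ (hV : ∀ t i j, 0 ≤ V t i j) {η : ℝ} (hη : 0 ≤ η) {m : ℕ}
    {i r j : α} (hir : η ≤ V m i r) (hrj : η ^ m ≤ leftProd V m r j) :
    η ^ (m + 1) ≤ leftProd V (m + 1) i j :=
  calc η ^ (m + 1) = η * η ^ m := pow_succ' η m
    _ ≤ V m i r * leftProd V m r j := mul_le_mul hir hrj (pow_nonneg hη m) (hV m i r)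
    _ ≤ leftProd V (m + 1) i j :=
      Finset.single_le_sum (f := fun r => V m i r * leftProd V m r j)
        (fun r _ => mul_nonneg (hV m i r) (leftProd_nonneg hV m r j)) (Finset.mem_univ r)

theorem le_leftProd_of_le (hV : ∀ t i j, 0 ≤ V t i j) (hrow : ∀ t i, ∑ j, V t i j = 1)
    {c : ℝ} {n m : ℕ} {j : α} (hc : ∀ i, c ≤ leftProd V n i j) (hnm : n ≤ m) (i : α) :
    c ≤ leftProd V m i j := by
  induction m, hnm using Nat.le_induction generalizing i with
  | base => exact hc i
  | succ m _ ih =>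
    calc c = ∑ r, V m i r * c := by rw [← Finset.sum_mul, hrow, one_mul]
      _ ≤ leftProd V (m + 1) i j :=
        Finset.sum_le_sum fun r _ => mul_le_mul_of_nonneg_left (ih r) (hV m i r)

/-- The number of vertices reached with weight `η ^ m` from `j` grows each time `j` is a root. -/
theorem min_card_le_card_filter_pow_le_leftProd (hV : ∀ t i j, 0 ≤ V t i j) {η : ℝ} (hη : 0 ≤ η)
    (hdiag : ∀ t i, η ≤ V t i i) {G : ℕ → α → α → Prop} (hG : ∀ t i j, G t i j → η ≤ V t j i)
    {R : ℕ → Finset α} (hR : ∀ t, ∀ j ∈ R t, ∀ i, Relation.ReflTransGen (G t) j i)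
    (j : α) (m : ℕ) :
    min (Fintype.card α) (((Finset.range m).filter fun t => j ∈ R t).card + 1) ≤
      (Finset.univ.filter fun i => η ^ m ≤ leftProd V m i j).card := by
  have hj : ∀ m, η ^ m ≤ leftProd V m j j := fun m => by
    induction m with
    | zero => simp [leftProd]
    | succ m ih => exact pow_succ_le_leftProd_succ hV hη (hdiag m j) ih
  induction m with
  | zero =>
    refine (min_le_right _ _).trans ?_
    simpa using ⟨j, by simpa using hj 0⟩
  | succ m ih =>
    set A := Finset.univ.filter fun i => η ^ m ≤ leftProd V m i j with hA
    set B := Finset.univ.filter fun i => η ^ (m + 1) ≤ leftProd V (m + 1) i j with hB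
    have hAB : A ⊆ B := fun i hi => by
      simp only [hA, hB, Finset.mem_filter_univ] at hi ⊢
      exact pow_succ_le_leftProd_succ hV hη (hdiag m i) hi
    have hle := Finset.card_le_card hAB
    rw [Finset.range_add_one, Finset.filter_insert]
    split_ifs with hroot
    · rw [Finset.card_insert_of_notMem (by simp)]
      by_cases hAu : A = Finset.univ
      · rw [hAu, Finset.card_univ] at hle
        exact (min_le_left _ _).trans hle
      · obtain ⟨r, hr, i, hi, hri⟩ := exists_arc_leaving (hR m j hroot) (A := (A : Set α))
          (by simpa [hA] using hj m) (by simpa using hAu)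
        have hiB : i ∈ B := by
          simp only [hA, hB, Finset.mem_filter_univ, Finset.coe_filter, Finset.mem_univ, true_and,
            Set.mem_ofPred_eq] at hr ⊢
          exact pow_succ_le_leftProd_succ hV hη (hG m r i hri) hr
        have hlt : A.card < B.card :=
          Finset.card_lt_card ⟨hAB, fun h => hi (by simpa using h hiB)⟩
        omega
    · exact ih.trans hle

end LeftProd

theorem stmt16 (H κ : ℕ) (hH : 2 ≤ H) (hκ1 : 1 ≤ κ) (hκH : κ ≤ H)
    (η : ℝ) (hη0 : 0 < η) (hη1 : η ≤ 1)
    (W : ℕ → Matrix (Fin H) (Fin H) ℝ)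
    (hnonneg : ∀ t i j, 0 ≤ W t i j)
    (hrow : ∀ t i, ∑ j, W t i j = 1)
    (hdiag : ∀ t i, η ≤ W t i i)
    (hG : ∀ t, ∃ G : Fin H → Fin H → Prop,
      (∀ i, G i i) ∧
      κ ≤ {i : Fin H | ∀ j, Relation.ReflTransGen G i j}.ncard ∧
      (∀ i j, G i j → η ≤ W t j i))
    (pivec : ℕ → Fin H → ℝ)
    (hpinonneg : ∀ t i, 0 ≤ pivec t i)
    (hpisum : ∀ t, ∑ i, pivec t i = 1)
    (hlim : ∀ τ i j,
      Tendsto (fun m => backProd H W τ m i j) atTop (nhds (pivec τ j))) :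
    ∀ τ : ℕ, ∃ S : Finset (Fin H), κ ≤ S.card ∧
      ∀ j ∈ S, η ^ ((H - κ + 1) * (H - 2) + 1) ≤ pivec τ j := by
  classical
  intro τ
  choose G _ hGroots hGarc using fun t => hG (τ + t)
  set l := (H - κ + 1) * (H - 2) + 1 with hl
  have hV : ∀ t i j, 0 ≤ W (τ + t) i j := fun t => hnonneg (τ + t)
  let R : ℕ → Finset (Fin H) := fun t =>
    Finset.univ.filter fun j => ∀ i, Relation.ReflTransGen (G t) j i
  refine ⟨Finset.univ.filter fun j => H - 2 < ((Finset.range l).filter fun t => j ∈ R t).card,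
    ?_, fun j hj => ?_⟩
  · refine le_card_filter_lt_card_of_lt (by simpa using hκH) _ (fun t => ?_) (by simp [hl])
    rw [← Set.ncard_coe_finset]
    simpa [R] using hGroots t
  · have hcard := min_card_le_card_filter_pow_le_leftProd hV hη0.le
      (fun t => hdiag (τ + t)) hGarc
      (R := R) (fun t j hj => (Finset.mem_filter.mp hj).2) j l
    simp only [Finset.mem_filter_univ] at hj
    rw [min_eq_left (by rw [Fintype.card_fin]; omega)] at hcard
    have hfull := Finset.eq_univ_of_card _ (le_antisymm (Finset.card_le_univ _) hcard)
    have hl_le : ∀ i, η ^ l ≤ leftProd (fun t => W (τ + t)) l i j := fun i => by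
      simpa using Finset.ext_iff.mp hfull i
    refine ge_of_tendsto (hlim τ j j) ?_
    filter_upwards [eventually_ge_atTop l] with m hm
    rw [backProd_eq_leftProd]
    exact le_leftProd_of_le hV (fun t => hrow (τ + t)) hl_le (by omega) j
end

section
/- Let H ≥ 1, d ≥ 1, D ≥ 0, and let f_1,…,f_H : ℝ^d → ℝ be convex functions, and for each i let g_i : ℝ^d → ℝ^d satisfy: for every x, g_i(x) is a subgradient of f_i at x and ‖g_i(x)‖ ≤ D. Consider the dynamics v_i(t) = Σ_{j=1}^H [W(t)]_{ij} x_j(t), x_i(t+1) = v_i(t) − α(t) g_i(v_i(t)), where each W(t) is an H×H row-stochastic matrix, {π(t)} is a sequence of stochastic vectors with π(t)ᵀ = π(t+1)ᵀ W(t) for all t, and there is λ ∈ (0,1) such that |[W(t)W(t−1)⋯W(τ)]_{ij} − π_j(τ)| ≤ 2λ^{t−τ} for all t ≥ τ ≥ 0 and all i,j. Assume the stepsizes α(t) are positive, non-increasing, with Σ_t α(t) = ∞ and Σ_t α(t)² < ∞. Suppose there exist a nonempty set X* ⊆ ℝ^d, a subset S ⊆ {1,…,H}, and p > 0 such that: π_i(t)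 ≥ p for all i ∈ S and all t; X* = argmin_x Σ_{i∈S} f_i(x); and X* ⊆ argmin_x f_i(x) for every i ∈ {1,…,H}. Then there exists x* ∈ X* such that x_i(t) → x* as t → ∞ for every i ∈ {1,…,H}; that is, all agents' states asymptotically reach a consensus at the same optimal point x* ∈ X*. -/
open Filter RealInnerProductSpace

/-- A nonnegative sequence that is halved every `N` steps up to a vanishing error vanishes. -/
theorem tendsto_zero_of_halving {a b : ℕ → ℝ} {N : ℕ} (hN : 0 < N) (ha : ∀ t, 0 ≤ a t)
    (hab : ∀ t, a (t + N) ≤ a t / 2 + b t) (hb : Tendsto b atTop (nhds 0)) :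
    Tendsto a atTop (nhds 0) := by
  rw [Metric.tendsto_atTop]
  intro ε hε
  obtain ⟨T, hT⟩ := eventually_atTop.1 (hb.eventually_le_const (show 0 < ε / 4 by positivity))
  have key : ∀ k t, T ≤ t → a (t + k * N) ≤ (1 / 2) ^ k * a t + ε / 2 := by
    intro k
    induction k with
    | zero => intro t _; simp; positivity
    | succ k ih =>
      intro t ht
      have h1 := hab (t + k * N)
      have h2 := ih t ht
      have h3 := hT (t + k * N) (by omega)
      have h4 : t + (k + 1) * N = t + k * N + N := by ring
      rw [h4, pow_succ]
      linarith
  set A := ∑ r ∈ Finset.range N, a (T + r) with hA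
  have hlim : Tendsto (fun k : ℕ => (1 / 2 : ℝ) ^ k * A) atTop (nhds 0) := by
    simpa using (tendsto_pow_atTop_nhds_zero_of_lt_one (by norm_num : (0 : ℝ) ≤ 1 / 2)
      (by norm_num)).mul_const A
  obtain ⟨K, hK⟩ := eventually_atTop.1 (hlim.eventually_lt_const (show 0 < ε / 2 by positivity))
  refine ⟨T + K * N, fun t ht => ?_⟩
  rw [Real.dist_eq, sub_zero, abs_of_nonneg (ha t)]
  have hr : (t - T) % N < N := Nat.mod_lt _ hN
  have hk : K ≤ (t - T) / N := (Nat.le_div_iff_mul_le hN).2 (by omega)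
  have ht' : t = T + (t - T) % N + (t - T) / N * N := by
    have := Nat.mod_add_div' (t - T) N
    omega
  have h1 := key ((t - T) / N) (T + (t - T) % N) (by omega)
  rw [← ht'] at h1
  have h2 : a (T + (t - T) % N) ≤ A :=
    Finset.single_le_sum (f := fun r => a (T + r)) (fun r _ => ha _) (Finset.mem_range.2 hr)
  have h3 := hK _ hk
  have h4 : (1 / 2 : ℝ) ^ ((t - T) / N) * a (T + (t - T) % N) ≤ (1 / 2) ^ ((t - T) / N) * A := by
    gcongr
  linarith

/-- The deterministic Robbins–Siegmund lemma. -/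
theorem summable_and_tendsto_of_le_sub_add {V u c : ℕ → ℝ} (hV : ∀ t, 0 ≤ V t)
    (hu : ∀ t, 0 ≤ u t) (hc : ∀ t, 0 ≤ c t) (hcs : Summable c)
    (hstep : ∀ t, V (t + 1) ≤ V t - u t + c t) :
    Summable u ∧ ∃ L, Tendsto V atTop (nhds L) := by
  have hle : ∀ t, ∑ s ∈ Finset.range t, c s ≤ ∑' s, c s := fun t =>
    hcs.sum_le_tsum _ (fun s _ => hc s)
  constructor
  · refine summable_of_sum_range_le (c := V 0 + ∑' s, c s) hu fun n => ?_
    have : V n + ∑ s ∈ Finset.range n, u s ≤ V 0 + ∑ s ∈ Finset.range n, c s := by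
      induction n with
      | zero => simp
      | succ n ih =>
        rw [Finset.sum_range_succ, Finset.sum_range_succ]
        linarith [hstep n]
    linarith [hV n, hle n]
  · have hanti : Antitone fun t => V t - ∑ s ∈ Finset.range t, c s := by
      refine antitone_nat_of_succ_le fun t => ?_
      rw [Finset.sum_range_succ]
      linarith [hstep t, hu t]
    have hbdd : BddBelow (Set.range fun t => V t - ∑ s ∈ Finset.range t, c s) := by
      refine ⟨-∑' s, c s, ?_⟩
      rintro _ ⟨t, rfl⟩
      change -∑' s, c s ≤ V t - ∑ s ∈ Finset.range t, c s
      linarith [hV t, hle t]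
    have h := (tendsto_atTop_ciInf hanti hbdd).add hcs.hasSum.tendsto_sum_nat
    exact ⟨_, h.congr fun t => by ring⟩

/-- If `∑ α = ∞` and `∑ α q < ∞`, then `q` vanishes along a subsequence. -/
theorem exists_subseq_tendsto_zero_of_summable_mul {α q : ℕ → ℝ} (hα : ∀ t, 0 < α t)
    (hq : ∀ t, 0 ≤ q t) (hdiv : ¬ Summable α) (hs : Summable fun t => α t * q t) :
    ∃ φ : ℕ → ℕ, StrictMono φ ∧ Tendsto (q ∘ φ) atTop (nhds 0) := by
  have hfreq : ∀ n : ℕ, ∃ᶠ k in atTop, q k < 1 / ((n : ℝ) + 1) := by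
    intro n hn
    apply hdiv
    have hpos : (0 : ℝ) < (n : ℝ) + 1 := by positivity
    refine Summable.of_norm_bounded_eventually_nat (hs.mul_left ((n : ℝ) + 1)) ?_
    filter_upwards [hn] with k hk
    rw [Real.norm_of_nonneg (hα k).le]
    have h1 : 1 ≤ ((n : ℝ) + 1) * q k := by
      rw [not_lt, div_le_iff₀ hpos] at hk
      linarith
    nlinarith [hα k]
  obtain ⟨φ, hφ, hlt⟩ := extraction_forall_of_frequently hfreq
  exact ⟨φ, hφ, squeeze_zero (fun n => hq _) (fun n => (hlt n).le)
    tendsto_one_div_add_atTop_nhds_zero_nat⟩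

section Averages

variable {ι E : Type*} [Fintype ι] [NormedAddCommGroup E]

theorem sum_smul_sub_of_sum_eq_one [Module ℝ E] {w : ι → ℝ} (hw1 : ∑ i, w i = 1) (x : ι → E)
    (z : E) : (∑ i, w i • x i) - z = ∑ i, w i • (x i - z) := by
  simp_rw [smul_sub, Finset.sum_sub_distrib, ← Finset.sum_smul, hw1, one_smul]

variable [NormedSpace ℝ E]

theorem norm_sum_smul_le_of_forall_le {w : ι → ℝ} (hw : ∀ i, 0 ≤ w i) (hw1 : ∑ i, w i = 1)
    {x : ι → E} {C : ℝ} (hx : ∀ i, ‖x i‖ ≤ C) : ‖∑ i, w i • x i‖ ≤ C := by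
  calc ‖∑ i, w i • x i‖ ≤ ∑ i, w i * C := norm_sum_le_of_le _ fun i _ => by
        rw [norm_smul, Real.norm_of_nonneg (hw i)]
        exact mul_le_mul_of_nonneg_left (hx i) (hw i)
    _ = C := by rw [← Finset.sum_mul, hw1, one_mul]

theorem norm_sq_sum_smul_sub_le {w : ι → ℝ} (hw : ∀ i, 0 ≤ w i) (hw1 : ∑ i, w i = 1)
    (x : ι → E) (z : E) : ‖(∑ i, w i • x i) - z‖ ^ 2 ≤ ∑ i, w i * ‖x i - z‖ ^ 2 := by
  rw [sum_smul_sub_of_sum_eq_one hw1]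
  have h : ConvexOn ℝ Set.univ fun y : E => ‖y‖ ^ 2 :=
    convexOn_univ_norm.pow (fun _ _ => norm_nonneg _) 2
  simpa using h.map_sum_le (t := Finset.univ) (p := fun i => x i - z) (fun i _ => hw i) hw1
    (fun _ _ => Set.mem_univ _)

end Averages

section Consensus

variable {E : Type*} [NormedAddCommGroup E] [NormedSpace ℝ E] {H : ℕ}
  {W : ℕ → Matrix (Fin H) (Fin H) ℝ} {x e : ℕ → Fin H → E} {w : ℕ → Fin H → ℝ} {c : ℕ → ℝ}

theorem norm_sub_backProd_le (hW : ∀ t i j, 0 ≤ W t i j) (hW1 : ∀ t i, ∑ j, W t i j = 1)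
    (hx : ∀ t i, x (t + 1) i = (∑ j, W t i j • x t j) - e t i) (he : ∀ t i, ‖e t i‖ ≤ c t)
    (hc : Antitone c) (s m : ℕ) (i : Fin H) :
    ‖x (s + m + 1) i - ∑ j, backProd H W s m i j • x s j‖ ≤ (m + 1) * c s := by
  induction m generalizing i with
  | zero => simpa [hx, backProd] using he s i
  | succ m ih =>
    have h1 : ∑ k, backProd H W s (m + 1) i k • x s k
        = ∑ j, W (s + m + 1) i j • ∑ k, backProd H W s m j k • x s k := by
      simp_rw [backProd, Matrix.mul_apply, Finset.sum_smul, Finset.smul_sum, smul_smul]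
      exact Finset.sum_comm
    have h2 : x (s + (m + 1) + 1) i - ∑ k, backProd H W s (m + 1) i k • x s k
        = (∑ j, W (s + m + 1) i j • (x (s + m + 1) j - ∑ k, backProd H W s m j k • x s k))
          - e (s + m + 1) i := by
      rw [h1, ← add_assoc, hx]
      simp_rw [smul_sub, Finset.sum_sub_distrib]
      abel
    rw [h2]
    have h3 := norm_sum_smul_le_of_forall_le (hW (s + m + 1) i) (hW1 (s + m + 1) i) ih
    have h4 := (he (s + m + 1) i).trans (hc (by omega : s ≤ s + m + 1))
    push_cast
    linarith [norm_sub_le (∑ j, W (s + m + 1) i j •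
      (x (s + m + 1) j - ∑ k, backProd H W s m j k • x s k)) (e (s + m + 1) i)]

theorem sum_backProd_eq_one (hW1 : ∀ t i, ∑ j, W t i j = 1) (s m : ℕ) (i : Fin H) :
    ∑ j, backProd H W s m i j = 1 := by
  induction m generalizing i with
  | zero => exact hW1 s i
  | succ m ih =>
    simp_rw [backProd, Matrix.mul_apply]
    rw [Finset.sum_comm]
    simp_rw [← Finset.mul_sum, ih, mul_one, hW1]

/-- Perturbed averaging with vanishing perturbations reaches consensus on the weighted average,
when the backward products contract geometrically to the weights. -/
theorem tendsto_sub_average (hW : ∀ t i j, 0 ≤ W t i j) (hW1 : ∀ t i, ∑ j, W t i j = 1)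
    (hx : ∀ t i, x (t + 1) i = (∑ j, W t i j • x t j) - e t i) (he : ∀ t i, ‖e t i‖ ≤ c t)
    (hc : Antitone c) (hc0 : Tendsto c atTop (nhds 0))
    (hw : ∀ t i, 0 ≤ w t i) (hw1 : ∀ t, ∑ i, w t i = 1)
    {lam : ℝ} (hlam0 : 0 ≤ lam) (hlam1 : lam < 1)
    (hΦ : ∀ s m i j, |backProd H W s m i j - w s j| ≤ 2 * lam ^ m) (i : Fin H) :
    Tendsto (fun t => x t i - ∑ j, w t j • x t j) atTop (nhds 0) := by
  set y : ℕ → E := fun t => ∑ j, w t j • x t j with hy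
  set M : ℕ → ℝ := fun t => ∑ j, ‖x t j - y t‖ with hM
  have hstep : ∀ s m k, ‖x (s + m + 1) k - y s‖ ≤ 2 * lam ^ m * M s + (m + 1) * c s := by
    intro s m k
    have h1 : (∑ j, backProd H W s m k j • x s j) - y s
        = ∑ j, (backProd H W s m k j - w s j) • (x s j - y s) := by
      have h2 : ∑ j, w s j • (x s j - y s) = 0 := by
        rw [← sum_smul_sub_of_sum_eq_one (hw1 s), sub_self]
      rw [sum_smul_sub_of_sum_eq_one (sum_backProd_eq_one hW1 s m k)]
      simp_rw [sub_smul _ _ (x s _ - y s), Finset.sum_sub_distrib]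
      rw [h2, sub_zero]
    have h3 : ‖(∑ j, backProd H W s m k j • x s j) - y s‖ ≤ 2 * lam ^ m * M s := by
      rw [h1, hM, Finset.mul_sum]
      refine norm_sum_le_of_le _ fun j _ => ?_
      rw [norm_smul, Real.norm_eq_abs]
      exact mul_le_mul_of_nonneg_right (hΦ s m k j) (norm_nonneg _)
    have h4 := norm_sub_backProd_le hW hW1 hx he hc s m k
    linarith [norm_sub_le_norm_sub_add_norm_sub (x (s + m + 1) k)
      (∑ j, backProd H W s m k j • x s j) (y s)]
  have hMstep : ∀ s m, M (s + m + 1) ≤ 4 * H * lam ^ m * M s + 2 * H * (m + 1) * c s := by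
    intro s m
    have h1 : ‖y (s + m + 1) - y s‖ ≤ 2 * lam ^ m * M s + (m + 1) * c s := by
      rw [hy]
      simp only
      rw [sum_smul_sub_of_sum_eq_one (hw1 _)]
      exact norm_sum_smul_le_of_forall_le (hw _) (hw1 _) (hstep s m)
    have h2 : M (s + m + 1) ≤ ∑ _j : Fin H, 2 * (2 * lam ^ m * M s + (m + 1) * c s) := by
      refine Finset.sum_le_sum fun j _ => ?_
      have h3 := norm_sub_le_norm_sub_add_norm_sub (x (s + m + 1) j) (y s) (y (s + m + 1))
      rw [norm_sub_rev (y s)] at h3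
      linarith [hstep s m j]
    rw [Finset.sum_const, Finset.card_univ, Fintype.card_fin, nsmul_eq_mul] at h2
    linarith
  have hM0 : ∀ t, 0 ≤ M t := fun t => Finset.sum_nonneg fun j _ => norm_nonneg _
  obtain ⟨m, hm⟩ : ∃ m : ℕ, 4 * H * lam ^ m ≤ 1 / 2 := by
    have h : Tendsto (fun m : ℕ => 4 * (H : ℝ) * lam ^ m) atTop (nhds 0) := by
      simpa using (tendsto_pow_atTop_nhds_zero_of_lt_one hlam0 hlam1).const_mul (4 * (H : ℝ))
    exact (h.eventually_le_const (by norm_num : (0 : ℝ) < 1 / 2)).exists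
  have hMlim : Tendsto M atTop (nhds 0) := by
    refine tendsto_zero_of_halving (N := m + 1) (b := fun t => 2 * H * (m + 1) * c t)
      (Nat.succ_pos m) hM0 (fun t => ?_) (by simpa using hc0.const_mul (2 * (H : ℝ) * (m + 1)))
    have h1 := hMstep t m
    have h2 := mul_le_mul_of_nonneg_right hm (hM0 t)
    rw [← add_assoc]
    linarith
  refine squeeze_zero_norm (fun t => ?_) hMlim
  exact Finset.single_le_sum (f := fun j => ‖x t j - y t‖) (fun j _ => norm_nonneg _)
    (Finset.mem_univ i)

end Consensus

/-- One step of averaging followed by a subgradient move, measured by the weighted squared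
distance to `z`. -/
theorem sum_mul_norm_sq_subgradient_step_le {ι E : Type*} [Fintype ι] [NormedAddCommGroup E]
    [InnerProductSpace ℝ E] {f : ι → E → ℝ} {g : ι → E → E} {D a : ℝ}
    (hsub : ∀ i x y, f i x + ⟪g i x, y - x⟫ ≤ f i y) (hg : ∀ i x, ‖g i x‖ ≤ D) (ha : 0 ≤ a)
    {W : ι → ι → ℝ} (hW : ∀ i j, 0 ≤ W i j) (hW1 : ∀ i, ∑ j, W i j = 1)
    {w w' : ι → ℝ} (hw' : ∀ i, 0 ≤ w' i) (hw'1 : ∑ i, w' i = 1)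
    (hww' : ∀ j, w j = ∑ i, w' i * W i j) (x v : ι → E) (hv : ∀ i, v i = ∑ j, W i j • x j)
    (z : E) :
    ∑ i, w' i * ‖v i - a • g i (v i) - z‖ ^ 2 ≤
      ∑ i, w i * ‖x i - z‖ ^ 2 - 2 * a * ∑ i, w' i * (f i (v i) - f i z) + a ^ 2 * D ^ 2 := by
  have hmix : ∑ i, w' i * ‖v i - z‖ ^ 2 ≤ ∑ i, w i * ‖x i - z‖ ^ 2 := by
    calc ∑ i, w' i * ‖v i - z‖ ^ 2 ≤ ∑ i, w' i * ∑ j, W i j * ‖x j - z‖ ^ 2 := by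
          refine Finset.sum_le_sum fun i _ => mul_le_mul_of_nonneg_left ?_ (hw' i)
          rw [hv i]
          exact norm_sq_sum_smul_sub_le (hW i) (hW1 i) x z
      _ = ∑ i, w i * ‖x i - z‖ ^ 2 := by
          simp_rw [hww', Finset.mul_sum, Finset.sum_mul, ← mul_assoc]
          exact Finset.sum_comm
  have hmove : ∀ i, ‖v i - a • g i (v i) - z‖ ^ 2 ≤
      ‖v i - z‖ ^ 2 - 2 * a * (f i (v i) - f i z) + a ^ 2 * D ^ 2 := by
    intro i
    have h1 : v i - a • g i (v i) - z = (v i - z) - a • g i (v i) := by abel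
    rw [h1, norm_sub_sq_real, inner_smul_right, real_inner_comm, norm_smul, mul_pow,
      Real.norm_eq_abs, sq_abs]
    have h2 := hsub i (v i) z
    rw [← neg_sub (v i) z, inner_neg_right] at h2
    have h3 : ‖g i (v i)‖ ^ 2 ≤ D ^ 2 := pow_le_pow_left₀ (norm_nonneg _) (hg i _) 2
    have h4 := mul_le_mul_of_nonneg_left h3 (sq_nonneg a)
    have h5 : a * (f i (v i) - f i z) ≤ a * ⟪g i (v i), v i - z⟫ :=
      mul_le_mul_of_nonneg_left (by linarith) ha
    linarith
  calc ∑ i, w' i * ‖v i - a • g i (v i) - z‖ ^ 2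
      ≤ ∑ i, w' i * (‖v i - z‖ ^ 2 - 2 * a * (f i (v i) - f i z) + a ^ 2 * D ^ 2) :=
        Finset.sum_le_sum fun i _ => mul_le_mul_of_nonneg_left (hmove i) (hw' i)
    _ = ∑ i, w' i * ‖v i - z‖ ^ 2 - 2 * a * ∑ i, w' i * (f i (v i) - f i z)
          + a ^ 2 * D ^ 2 := by
        rw [Finset.mul_sum, ← Finset.sum_sub_distrib]
        conv_rhs => rw [← one_mul (a ^ 2 * D ^ 2), ← hw'1, Finset.sum_mul,
          ← Finset.sum_add_distrib]
        exact Finset.sum_congr rfl fun i _ => by ring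
    _ ≤ _ := by linarith

theorem stmt17 (H d : ℕ) (hH : 1 ≤ H) (hd : 1 ≤ d) (D : ℝ) (hD : 0 ≤ D)
    (f : Fin H → EuclideanSpace ℝ (Fin d) → ℝ)
    (g : Fin H → EuclideanSpace ℝ (Fin d) → EuclideanSpace ℝ (Fin d))
    (hconv : ∀ i, ConvexOn ℝ Set.univ (f i))
    (hsubgrad : ∀ i x y, f i x + ⟪g i x, y - x⟫ ≤ f i y)
    (hgbound : ∀ i x, ‖g i x‖ ≤ D)
    (lam : ℝ) (hlam0 : 0 < lam) (hlam1 : lam < 1)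
    (W : ℕ → Matrix (Fin H) (Fin H) ℝ)
    (x : ℕ → Fin H → EuclideanSpace ℝ (Fin d))
    (pivec : ℕ → Fin H → ℝ) (α : ℕ → ℝ)
    (hWnonneg : ∀ t i j, 0 ≤ W t i j)
    (hWrow : ∀ t i, ∑ j, W t i j = 1)
    (hdyn : ∀ t i, x (t + 1) i =
      (∑ j, W t i j • x t j) - α t • g i (∑ j, W t i j • x t j))
    (hpinonneg : ∀ t i, 0 ≤ pivec t i)
    (hpisum : ∀ t, ∑ i, pivec t i = 1)
    (hpiaps : ∀ t j, pivec t j = ∑ i, pivec (t + 1) i * W t i j)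
    (hPhi : ∀ τ m i j, |backProd H W τ m i j - pivec τ j| ≤ 2 * lam ^ m)
    (hαpos : ∀ t, 0 < α t) (hαmono : ∀ t, α (t + 1) ≤ α t)
    (hαdiv : ¬ Summable α) (hαsq : Summable fun t => (α t) ^ 2)
    (Xstar : Set (EuclideanSpace ℝ (Fin d))) (hXne : Xstar.Nonempty)
    (S : Finset (Fin H)) (p : ℝ) (hp : 0 < p)
    (hpiS : ∀ i ∈ S, ∀ t, p ≤ pivec t i)
    (hXargmin : Xstar = argminSet (fun z => ∑ i ∈ S, f i z))
    (hXopt : ∀ i : Fin H, Xstar ⊆ argminSet (f i)) :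
    ∃ xstar ∈ Xstar, ∀ i, Tendsto (fun t => x t i) atTop (nhds xstar) := by
  have hα0 : Tendsto α atTop (nhds 0) := by
    have h := hαsq.tendsto_atTop_zero.sqrt
    simpa [Real.sqrt_sq (hαpos _).le] using h
  have hcons : ∀ i, Tendsto (fun t => x t i - ∑ j, pivec t j • x t j) atTop (nhds 0) := by
    refine tendsto_sub_average (c := fun t => α t * D) hWnonneg hWrow hdyn (fun t i => ?_)
      ((antitone_nat_of_succ_le hαmono).mul_const hD) (by simpa using hα0.mul_const D)
      hpinonneg hpisum hlam0.le hlam1 hPhi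
    rw [norm_smul, Real.norm_of_nonneg (hαpos t).le]
    exact mul_le_mul_of_nonneg_left (hgbound i _) (hαpos t).le
  set y : ℕ → EuclideanSpace ℝ (Fin d) := fun t => ∑ j, pivec t j • x t j with hy
  set v : ℕ → Fin H → EuclideanSpace ℝ (Fin d) := fun t i => ∑ j, W t i j • x t j with hv
  have hvy : ∀ i, Tendsto (fun t => v t i - y t) atTop (nhds 0) := by
    intro i
    have h : Tendsto (fun t => ∑ j, ‖x t j - y t‖) atTop (nhds 0) := by
      simpa using tendsto_finsetSum Finset.univ fun j _ => (hcons j).norm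
    refine squeeze_zero_norm (fun t => ?_) h
    rw [hv]
    simp only
    rw [sum_smul_sub_of_sum_eq_one (hWrow t i)]
    exact norm_sum_smul_le_of_forall_le (hWnonneg t i) (hWrow t i) fun j =>
      Finset.single_le_sum (f := fun j => ‖x t j - y t‖) (fun j _ => norm_nonneg _)
        (Finset.mem_univ j)
  set V : EuclideanSpace ℝ (Fin d) → ℕ → ℝ :=
    fun z t => ∑ i, pivec t i * ‖x t i - z‖ ^ 2 with hV
  set q : EuclideanSpace ℝ (Fin d) → ℕ → ℝ :=
    fun z t => ∑ i ∈ S, (f i (v t i) - f i z) with hq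
  have hgap : ∀ z ∈ Xstar, ∀ t i, 0 ≤ f i (v t i) - f i z := fun z hz t i =>
    sub_nonneg.2 (hXopt i hz _)
  have hq0 : ∀ z ∈ Xstar, ∀ t, 0 ≤ q z t := fun z hz t =>
    Finset.sum_nonneg fun i _ => hgap z hz t i
  have hVstep : ∀ z ∈ Xstar, ∀ t,
      V z (t + 1) ≤ V z t - 2 * p * (α t * q z t) + α t ^ 2 * D ^ 2 := by
    intro z hz t
    have h1 := sum_mul_norm_sq_subgradient_step_le hsubgrad hgbound (hαpos t).le (hWnonneg t)
      (hWrow t) (hpinonneg (t + 1)) (hpisum (t + 1)) (hpiaps t) (x t) (v t) (fun i => rfl) z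
    have h2 : V z (t + 1) = ∑ i, pivec (t + 1) i * ‖v t i - α t • g i (v t i) - z‖ ^ 2 := by
      simp only [hV, hdyn, hv]
    have h3 : p * q z t ≤ ∑ i, pivec (t + 1) i * (f i (v t i) - f i z) := by
      rw [hq, Finset.mul_sum]
      refine (Finset.sum_le_sum fun i hi =>
        mul_le_mul_of_nonneg_right (hpiS i hi (t + 1)) (hgap z hz t i)).trans ?_
      exact Finset.sum_le_sum_of_subset_of_nonneg (Finset.subset_univ S) fun i _ _ =>
        mul_nonneg (hpinonneg _ i) (hgap z hz t i)
    have h4 := mul_le_mul_of_nonneg_left h3 (hαpos t).le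
    rw [h2]
    linarith
  have hV0 : ∀ z t, 0 ≤ V z t := fun z t =>
    Finset.sum_nonneg fun i _ => mul_nonneg (hpinonneg t i) (sq_nonneg _)
  have hRS : ∀ z ∈ Xstar, Summable (fun t => 2 * p * (α t * q z t)) ∧
      ∃ L, Tendsto (V z) atTop (nhds L) := fun z hz =>
    summable_and_tendsto_of_le_sub_add (hV0 z)
      (fun t => mul_nonneg (by positivity) (mul_nonneg (hαpos t).le (hq0 z hz t)))
      (fun t => by positivity) (hαsq.mul_right (D ^ 2)) (hVstep z hz)
  have hyV : ∀ z t, ‖y t - z‖ ^ 2 ≤ V z t := fun z t =>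
    norm_sq_sum_smul_sub_le (hpinonneg t) (hpisum t) (x t) z
  obtain ⟨z, hz⟩ := hXne
  obtain ⟨hsum, L, hL⟩ := hRS z hz
  obtain ⟨φ, hφ, hqφ⟩ := exists_subseq_tendsto_zero_of_summable_mul hαpos (hq0 z hz) hαdiv
    ((summable_mul_left_iff (by positivity)).1 hsum)
  obtain ⟨B, hB⟩ := hL.bddAbove_range
  have hybdd : ∀ t, y t ∈ Metric.closedBall z (Real.sqrt B) := by
    intro t
    rw [Metric.mem_closedBall, dist_eq_norm]
    exact Real.le_sqrt_of_sq_le ((hyV z t).trans (hB ⟨t, rfl⟩))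
  obtain ⟨ystar, -, ψ, hψ, hyψ⟩ :=
    (isCompact_closedBall z (Real.sqrt B)).tendsto_subseq fun n => hybdd (φ n)
  have hθ : Tendsto (φ ∘ ψ) atTop atTop := (hφ.comp hψ).tendsto_atTop
  have hxθ : ∀ i, Tendsto (fun n => x (φ (ψ n)) i) atTop (nhds ystar) := fun i => by
    have h := ((hcons i).comp hθ).add hyψ
    rw [zero_add] at h
    exact h.congr fun n => sub_add_cancel _ _
  have hvθ : ∀ i, Tendsto (fun n => v (φ (ψ n)) i) atTop (nhds ystar) := fun i => by
    simpa using ((hvy i).comp hθ).add hyψ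
  have hcont : ∀ i, Continuous (f i) := fun i =>
    continuousOn_univ.1 ((hconv i).continuousOn isOpen_univ)
  have hval : ∑ i ∈ S, (f i ystar - f i z) = 0 := by
    refine tendsto_nhds_unique ?_ (hqφ.comp hψ.tendsto_atTop)
    exact tendsto_finsetSum S fun i _ =>
      (((hcont i).tendsto ystar).comp (hvθ i)).sub_const (f i z)
  have hystar : ystar ∈ Xstar := by
    rw [Finset.sum_sub_distrib, sub_eq_zero] at hval
    rw [hXargmin] at hz ⊢
    intro u
    exact hval.le.trans (hz u)
  obtain ⟨-, L', hL'⟩ := hRS ystar hystar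
  have hL'0 : L' = 0 := by
    refine tendsto_nhds_unique (hL'.comp hθ) ?_
    have h : Tendsto (fun n => ∑ i, ‖x (φ (ψ n)) i - ystar‖ ^ 2) atTop (nhds 0) := by
      simpa using tendsto_finsetSum Finset.univ fun i _ =>
        (((hxθ i).sub_const ystar).norm.pow 2)
    refine squeeze_zero (fun n => hV0 _ _) (fun n => Finset.sum_le_sum fun i _ => ?_) h
    have h1 : pivec (φ (ψ n)) i ≤ 1 := by
      rw [← hpisum (φ (ψ n))]
      exact Finset.single_le_sum (fun j _ => hpinonneg _ j) (Finset.mem_univ i)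
    exact mul_le_of_le_one_left (sq_nonneg _) h1
  rw [hL'0] at hL'
  have hylim : Tendsto y atTop (nhds ystar) := by
    rw [tendsto_iff_norm_sub_tendsto_zero]
    have h := (squeeze_zero (fun t => sq_nonneg _) (hyV ystar) hL').sqrt
    simpa [Real.sqrt_sq] using h
  refine ⟨ystar, hystar, fun i => ?_⟩
  have h := (hcons i).add hylim
  rw [zero_add] at h
  exact h.congr fun t => sub_add_cancel _ _
end
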